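/- arXiv:q-alg/9612009 — 8 statements merged into one kernel-verified Lean document; each statement's English description precedes it below -/
import Mathlib

section
/- Let K be a field of characteristic zero, q ∈ K nonzero with q² ≠ 1, and V a K-vector space. Let X : ℤ → End_K(V) be a q-current and let K⁻ : ℕ → End_K(V) satisfy conditions (I)–(II) for X; let X̄_j be the associated modified current modes. Then for all i, j ∈ ℤ: X̄_{i+1}∘X̄_j − X̄_i∘X̄_{j+1} = X̄_j∘X̄_{i+1} − X̄_{j+1}∘X̄_i. (This is the coefficient form of the identity (z−w)·x̄(z)x̄(w) = (z−w)·x̄(w)x̄(z) for x̄(z) = x(z)k⁻(z).) -/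
/-- A family `X : ℤ → End V` is a *`q`-current* if
`X_{i+1}∘X_j − q²·X_i∘X_{j+1} = q²·X_j∘X_{i+1} − X_{j+1}∘X_i`, the coefficient form of
`(z − q²w)x(z)x(w) = (q²z − w)x(w)x(z)` for `x(z) = Σ_n X_n z^{−n}`. -/
def IsQCurrent {K : Type*} [Field K] {V : Type*} [AddCommGroup V] [Module K V]
    (q : K) (X : ℤ → Module.End K V) : Prop :=
  ∀ i j : ℤ, X (i + 1) * X j - q ^ 2 • (X i * X (j + 1)) =
    q ^ 2 • (X j * X (i + 1)) - X (j + 1) * X i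

/-- Conditions (I)–(II) for `K⁻ : ℕ → End V` relative to a current `X`:
`K⁻_0 = id`, the `K⁻_a` pairwise commute, for every `v` only finitely many `K⁻_a v` are
nonzero, and `K⁻_a∘X_b = X_b∘K⁻_a + (1 − q²)·Σ_{m=1}^{a} X_{b+m}∘K⁻_{a−m}`, the
coefficient form (with `(z−wq²)/(z−w)` expanded in `w/z`) of
`k⁻(z)x(w) = ((z−wq²)/(z−w))·x(w)k⁻(z)` for `k⁻(z) = Σ_{a≥0} K⁻_a z^{−a}`. -/
def CondMinus {K : Type*} [Field K] {V : Type*} [AddCommGroup V] [Module K V]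
    (q : K) (X : ℤ → Module.End K V) (Km : ℕ → Module.End K V) : Prop :=
  Km 0 = 1 ∧ (∀ a b : ℕ, Km a * Km b = Km b * Km a) ∧
    (∀ v : V, {a : ℕ | Km a v ≠ 0}.Finite) ∧
    (∀ (a : ℕ) (b : ℤ), Km a * X b =
      X b * Km a + (1 - q ^ 2) • ∑ m ∈ Finset.Icc 1 a, X (b + (m : ℤ)) * Km (a - m))

/-- The modified current mode `X̄_j`, applied to a vector:
`X̄_j v = Σ_{a≥0} X_{j−a}(K⁻_a v)` (a finite sum); `X̄_j` is the coefficient of `z^{−j}`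
in `x̄(z) = x(z)k⁻(z)`. -/
noncomputable def XbarApp {K : Type*} [Field K] {V : Type*} [AddCommGroup V] [Module K V]
    (X : ℤ → Module.End K V) (Km : ℕ → Module.End K V) (j : ℤ) (v : V) : V :=
  ∑ᶠ a : ℕ, X (j - (a : ℤ)) (Km a v)

namespace CondMinus

variable {K : Type*} [Field K] {V : Type*} [AddCommGroup V] [Module K V]
  {q : K} {X : ℤ → Module.End K V} {Km : ℕ → Module.End K V}

theorem exists_forall_ge_apply_eq_zero (hK : CondMinus q X Km) (v : V) :
    ∃ M : ℕ, ∀ a, M ≤ a → Km a v = 0 := by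
  obtain ⟨M, hM⟩ := (hK.2.2.1 v).bddAbove
  refine ⟨M + 1, fun a ha => ?_⟩
  by_contra h
  have : a ≤ M := hM h
  omega

theorem finite_support (hK : CondMinus q X Km) (j : ℤ) (v : V) :
    (Function.support fun a : ℕ => X (j - (a : ℤ)) (Km a v)).Finite := by
  refine (hK.2.2.1 v).subset fun a ha => ?_
  contrapose! ha
  simp_all

theorem xbarApp_eq_sum_range (X : ℤ → Module.End K V) {v : V} {M : ℕ}
    (hM : ∀ a, M ≤ a → Km a v = 0) (j : ℤ) :
    XbarApp X Km j v = ∑ a ∈ Finset.range M, X (j - (a : ℤ)) (Km a v) := by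
  refine finsum_eq_sum_of_support_subset _ fun a ha => ?_
  contrapose! ha
  have : Km a v = 0 := hM a (by simpa using ha)
  simp [this]

theorem xbarApp_sum (hK : CondMinus q X Km) {ι : Type*} (s : Finset ι) (u : ι → V) (j : ℤ) :
    XbarApp X Km j (∑ b ∈ s, u b) = ∑ b ∈ s, XbarApp X Km j (u b) := by
  simp only [XbarApp, map_sum]
  exact finsum_sum_comm s _ fun b _ => hK.finite_support j (u b)

/-- The defining relation of `K⁻` with the denominator `z - w` cleared. -/
theorem apply_succ_sub (hK : CondMinus q X Km) (a : ℕ) (b : ℤ) (v : V) :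
    Km (a + 1) (X b v) - Km a (X (b + 1) v) =
      X b (Km (a + 1) v) - q ^ 2 • X (b + 1) (Km a v) := by
  have h1 := LinearMap.congr_fun (hK.2.2.2 (a + 1) b) v
  have h2 := LinearMap.congr_fun (hK.2.2.2 a (b + 1)) v
  have h3 : ∑ m ∈ Finset.Icc 1 (a + 1), X (b + (m : ℤ)) (Km (a + 1 - m) v) =
      X (b + 1) (Km a v) + ∑ m ∈ Finset.Icc 1 a, X (b + 1 + (m : ℤ)) (Km (a - m) v) := by
    rw [← Finset.Ico_add_one_right_eq_Icc, ← Finset.Ico_add_one_right_eq_Icc,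
      Finset.sum_eq_sum_Ico_succ_bot (by omega), ← Finset.sum_Ico_add' _ 1 (a + 1) 1]
    congr 1
    refine Finset.sum_congr rfl fun m _ => ?_
    rw [Nat.add_sub_add_right, Nat.cast_add_one, add_assoc, add_comm (m : ℤ)]
  simp only [Module.End.mul_apply, LinearMap.add_apply, LinearMap.smul_apply,
    LinearMap.sum_apply] at h1 h2
  rw [h1, h2, h3]
  module

theorem xbarApp_apply_sub (hK : CondMinus q X Km) (i j : ℤ) (u : V) :
    ∃ M : ℕ, ∀ N, M ≤ N →
      XbarApp X Km (i + 1) (X j u) - XbarApp X Km i (X (j + 1) u) =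
        ∑ a ∈ Finset.range N, (X (i - (a : ℤ) + 1) * X j -
          q ^ 2 • (X (i - (a : ℤ)) * X (j + 1))) (Km a u) := by
  obtain ⟨M₁, h₁⟩ := hK.exists_forall_ge_apply_eq_zero (X j u)
  obtain ⟨M₂, h₂⟩ := hK.exists_forall_ge_apply_eq_zero (X (j + 1) u)
  obtain ⟨M₃, h₃⟩ := hK.exists_forall_ge_apply_eq_zero u
  refine ⟨M₁ + M₂ + M₃, fun N hN => ?_⟩
  have hshift (w : ℕ → V) (hw : w N = 0) :
      ∑ a ∈ Finset.range N, X (i - (a : ℤ) + 1) (w a) =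
        X (i + 1) (w 0) + ∑ a ∈ Finset.range N, X (i - (a : ℤ)) (w (a + 1)) := by
    have h := Finset.sum_range_succ (fun a : ℕ => X (i - (a : ℤ) + 1) (w a)) N
    rw [Finset.sum_range_succ', hw, map_zero, add_zero] at h
    rw [← h, add_comm]
    simp [sub_add_eq_sub_sub]
  have hcomm (a : ℕ) : X (i - (a : ℤ)) (Km (a + 1) (X j u)) -
      X (i - (a : ℤ)) (Km a (X (j + 1) u)) =
      X (i - (a : ℤ)) (X j (Km (a + 1) u)) - q ^ 2 • X (i - (a : ℤ)) (X (j + 1) (Km a u)) := by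
    rw [← map_sub, hK.apply_succ_sub, map_sub, map_smul]
  rw [xbarApp_eq_sum_range X (M := N) (fun a ha => h₁ a (by omega)),
    xbarApp_eq_sum_range X (M := N) (fun a ha => h₂ a (by omega))]
  simp only [LinearMap.sub_apply, LinearMap.smul_apply, Module.End.mul_apply,
    Finset.sum_sub_distrib, add_sub_right_comm i 1]
  rw [hshift (fun a => Km a (X j u)) (h₁ N (by omega)),
    hshift (fun a => X j (Km a u)) (by rw [h₃ N (by omega), map_zero]),
    add_sub_assoc, add_sub_assoc, ← Finset.sum_sub_distrib, ← Finset.sum_sub_distrib]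
  simp [hcomm, hK.1]

theorem xbarApp_xbarApp_sub (hK : CondMinus q X Km) (i j : ℤ) (v : V) :
    ∃ M : ℕ, ∀ N, M ≤ N →
      XbarApp X Km (i + 1) (XbarApp X Km j v) - XbarApp X Km i (XbarApp X Km (j + 1) v) =
        ∑ b ∈ Finset.range N, ∑ a ∈ Finset.range N,
          (X (i - (a : ℤ) + 1) * X (j - (b : ℤ)) -
            q ^ 2 • (X (i - (a : ℤ)) * X (j - (b : ℤ) + 1))) (Km a (Km b v)) := by
  obtain ⟨M, hM⟩ := hK.exists_forall_ge_apply_eq_zero v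
  choose L hL using fun b : ℕ => hK.xbarApp_apply_sub i (j - (b : ℤ)) (Km b v)
  refine ⟨M + (Finset.range M).sup L, fun N hN => ?_⟩
  rw [xbarApp_eq_sum_range X hM, xbarApp_eq_sum_range X hM, hK.xbarApp_sum, hK.xbarApp_sum,
    ← Finset.sum_sub_distrib]
  rw [← Finset.sum_subset (Finset.range_mono (show M ≤ N by omega)) fun b _ hb => by
    simp [hM b (by simpa using hb)]]
  refine Finset.sum_congr rfl fun b hb => ?_
  have := Finset.le_sup (f := L) hb
  rw [add_sub_right_comm j 1, hL b N (by omega)]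

end CondMinus

/-- **(z−w)-commutativity of the modified current.**  For a `q`-current `X` and `K⁻`
satisfying (I)–(II), the modes `X̄_j` of `x̄(z) = x(z)k⁻(z)` satisfy
`X̄_{i+1}∘X̄_j − X̄_i∘X̄_{j+1} = X̄_j∘X̄_{i+1} − X̄_{j+1}∘X̄_i`, the coefficient form of
`(z−w)·x̄(z)x̄(w) = (z−w)·x̄(w)x̄(z)`. -/
theorem stmt_2 {K : Type*} [Field K] [CharZero K] {V : Type*} [AddCommGroup V] [Module K V]
    (q : K) (hq : q ≠ 0) (hq2 : q ^ 2 ≠ 1)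
    (X : ℤ → Module.End K V) (Km : ℕ → Module.End K V)
    (hX : IsQCurrent q X) (hK : CondMinus q X Km) :
    ∀ (i j : ℤ) (v : V),
      XbarApp X Km (i + 1) (XbarApp X Km j v) - XbarApp X Km i (XbarApp X Km (j + 1) v) =
        XbarApp X Km j (XbarApp X Km (i + 1) v) - XbarApp X Km (j + 1) (XbarApp X Km i v) := by
  intro i j v
  obtain ⟨M₁, h₁⟩ := hK.xbarApp_xbarApp_sub i j v
  obtain ⟨M₂, h₂⟩ := hK.xbarApp_xbarApp_sub j i v
  rw [h₁ (M₁ + M₂) (by omega), ← neg_sub (XbarApp X Km (j + 1) _), h₂ (M₁ + M₂) (by omega),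
    Finset.sum_comm, ← Finset.sum_neg_distrib]
  refine Finset.sum_congr rfl fun a _ => ?_
  rw [← Finset.sum_neg_distrib]
  refine Finset.sum_congr rfl fun b _ => ?_
  rw [hX, ← Module.End.mul_apply (Km a), hK.2.1, Module.End.mul_apply, ← LinearMap.neg_apply,
    neg_sub]
end

section
/- Let K be a field of characteristic zero, q ∈ K nonzero with q² ≠ 1, and V a K-vector space. Let X : ℤ → End_K(V) be a truncating q-current and let K⁻ : ℕ → End_K(V) satisfy conditions (I)–(II) for X; let X̄_j be the associated modified current modes. Then the operators X̄_j pairwise commute: X̄_i∘X̄_j = X̄_j∘X̄_i for all i, j ∈ ℤ. (This is the identity x̄(z)x̄(w) = x̄(w)x̄(z) for the commutative quantum current x̄(z) = x(z)k⁻(z).) -/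
/-- `X` is *truncating* if for every `v` there is `N` with `X_n v = 0` for all `n ≥ N`. -/
def Truncating {K : Type*} [Field K] {V : Type*} [AddCommGroup V] [Module K V]
    (X : ℤ → Module.End K V) : Prop :=
  ∀ v : V, ∃ N : ℤ, ∀ n : ℤ, N ≤ n → X n v = 0

section ModifiedCurrent

variable {K : Type*} [Field K] {V : Type*} [AddCommGroup V] [Module K V]
  {q : K} {X : ℤ → Module.End K V} {Km : ℕ → Module.End K V}

/-- The coefficient form of `(z − w)k⁻(z)x(w) = (z − q²w)x(w)k⁻(z)`. -/
lemma CondMinus.succ_mul_sub (hK : CondMinus q X Km) (a : ℕ) (b : ℤ) :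
    Km (a + 1) * X b - Km a * X (b + 1) =
      X b * Km (a + 1) - q ^ 2 • (X (b + 1) * Km a) := by
  have shift (n : ℕ) (f : ℕ → Module.End K V) :
      ∑ m ∈ Finset.Icc 1 n, f m = ∑ m ∈ Finset.range n, f (m + 1) := by
    induction n with
    | zero => simp
    | succ n ih => rw [Finset.sum_Icc_succ_top (by omega), ih, Finset.sum_range_succ]
  have key : ∑ m ∈ Finset.Icc 1 (a + 1), X (b + (m : ℤ)) * Km (a + 1 - m) =
      ∑ m ∈ Finset.Icc 1 a, X (b + 1 + (m : ℤ)) * Km (a - m) + X (b + 1) * Km a := by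
    rw [shift, shift, Finset.sum_range_succ']
    congr 1
    refine Finset.sum_congr rfl fun m _ => ?_
    rw [show b + ((m + 1 + 1 : ℕ) : ℤ) = b + 1 + ((m + 1 : ℕ) : ℤ) by push_cast; ring,
      show a + 1 - (m + 1 + 1) = a - (m + 1) by omega]
  rw [hK.2.2.2 (a + 1) b, hK.2.2.2 a (b + 1), key]
  module

lemma CondMinus.eventually_apply_eq_zero (hK : CondMinus q X Km) (v : V) :
    ∀ᶠ N : ℕ in Filter.atTop, ∀ a, N ≤ a → Km a v = 0 := by
  obtain ⟨N, hN⟩ := (hK.2.2.1 v).bddAbove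
  filter_upwards [Filter.eventually_gt_atTop N] with M hM a ha
  by_contra h
  have : a ≤ N := hN h
  omega

lemma XbarApp_eq_sum_range {v : V} {N : ℕ} (hN : ∀ a, N ≤ a → Km a v = 0) (j : ℤ) :
    XbarApp X Km j v = ∑ a ∈ Finset.range N, X (j - (a : ℤ)) (Km a v) := by
  refine finsum_eq_sum_of_support_subset _ fun a ha => ?_
  by_contra h
  exact ha (by simp [hN a (by simpa using h)])

lemma CondMinus.eventually_XbarApp_XbarApp (hK : CondMinus q X Km) {v : V} {N : ℕ}
    (hN : ∀ a, N ≤ a → Km a v = 0) (i j : ℤ) :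
    ∀ᶠ M : ℕ in Filter.atTop, XbarApp X Km i (XbarApp X Km j v) =
      ∑ a ∈ Finset.range M, ∑ b ∈ Finset.range N,
        X (i - (a : ℤ)) (Km a (X (j - (b : ℤ)) (Km b v))) := by
  filter_upwards [hK.eventually_apply_eq_zero (XbarApp X Km j v)] with M hM
  simp_rw [XbarApp_eq_sum_range hM i, XbarApp_eq_sum_range hN j, map_sum]

/-- The coefficient of `z^{−i} w^{−j}` in `x(z)x(w)k⁻(z)k⁻(w)v`, provided that `Km a v = 0` for
all `a ≥ N`. -/
def normalOrdered (X : ℤ → Module.End K V) (Km : ℕ → Module.End K V) (N : ℕ) (v : V)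
    (i j : ℤ) : V :=
  ∑ a ∈ Finset.range N, ∑ b ∈ Finset.range N,
    X (i - (a : ℤ)) (X (j - (b : ℤ)) (Km a (Km b v)))

lemma CondMinus.normalOrdered_eq_sum (hK : CondMinus q X Km) {v : V} {N M : ℕ}
    (hN : ∀ a, N ≤ a → Km a v = 0) (hM : N ≤ M) (i j : ℤ) :
    normalOrdered X Km N v i j = ∑ a ∈ Finset.range M, ∑ b ∈ Finset.range N,
      X (i - (a : ℤ)) (X (j - (b : ℤ)) (Km a (Km b v))) := by
  refine Finset.sum_subset (Finset.range_mono hM) fun a _ ha => Finset.sum_eq_zero fun b _ => ?_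
  have h := LinearMap.congr_fun (hK.2.1 a b) v
  simp only [Module.End.mul_apply] at h
  simp [h, hN a (by simpa using ha)]

/-- The coefficient form of `(z − w)x̄(z)x̄(w) = (z − q²w)x(z)x(w)k⁻(z)k⁻(w)`. -/
lemma CondMinus.XbarApp_XbarApp_sub (hK : CondMinus q X Km) {v : V} {N : ℕ}
    (hN : ∀ a, N ≤ a → Km a v = 0) (i j : ℤ) :
    XbarApp X Km (i + 1) (XbarApp X Km j v) - XbarApp X Km i (XbarApp X Km (j + 1) v) =
      normalOrdered X Km N v (i + 1) j - q ^ 2 • normalOrdered X Km N v i (j + 1) := by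
  obtain ⟨M, h₁, h₂, hM⟩ := (((Filter.tendsto_add_atTop_nat 1).eventually
    (hK.eventually_XbarApp_XbarApp hN (i + 1) j)).and
    ((hK.eventually_XbarApp_XbarApp hN i (j + 1)).and (Filter.eventually_ge_atTop N))).exists
  rw [h₁, h₂, hK.normalOrdered_eq_sum hN (hM.trans M.le_succ) (i + 1) j,
    hK.normalOrdered_eq_sum hN hM i (j + 1), Finset.sum_range_succ', Finset.sum_range_succ',
    add_sub_right_comm (Finset.sum _ _), add_sub_right_comm (Finset.sum _ _), Finset.smul_sum,
    ← Finset.sum_sub_distrib, ← Finset.sum_sub_distrib]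
  congr 1
  · refine Finset.sum_congr rfl fun a _ => ?_
    rw [Finset.smul_sum, ← Finset.sum_sub_distrib, ← Finset.sum_sub_distrib]
    refine Finset.sum_congr rfl fun b _ => ?_
    have h := LinearMap.congr_fun (hK.succ_mul_sub a (j - b)) (Km b v)
    simp only [LinearMap.sub_apply, LinearMap.smul_apply, Module.End.mul_apply] at h
    rw [show i + 1 - ((a + 1 : ℕ) : ℤ) = i - a by push_cast; ring,
      show j + 1 - (b : ℤ) = j - b + 1 by ring, ← map_sub, h, map_sub, map_smul]
  · simp [hK.1]

lemma IsQCurrent.normalOrdered_sub (hX : IsQCurrent q X) (hK : CondMinus q X Km) (N : ℕ) (v : V)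
    (i j : ℤ) :
    normalOrdered X Km N v (i + 1) j - q ^ 2 • normalOrdered X Km N v i (j + 1) =
      q ^ 2 • normalOrdered X Km N v j (i + 1) - normalOrdered X Km N v (j + 1) i := by
  have swap (k l : ℤ) : normalOrdered X Km N v k l =
      ∑ a ∈ Finset.range N, ∑ b ∈ Finset.range N,
        X (k - (b : ℤ)) (X (l - (a : ℤ)) (Km a (Km b v))) := by
    rw [normalOrdered, Finset.sum_comm]
    refine Finset.sum_congr rfl fun a _ => Finset.sum_congr rfl fun b _ => ?_
    rw [← Module.End.mul_apply (Km b), hK.2.1 b a, Module.End.mul_apply]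
  rw [swap j, swap (j + 1), normalOrdered, normalOrdered]
  simp only [Finset.smul_sum, ← Finset.sum_sub_distrib]
  refine Finset.sum_congr rfl fun a _ => Finset.sum_congr rfl fun b _ => ?_
  have h := LinearMap.congr_fun (hX (i - a) (j - b)) (Km a (Km b v))
  simp only [LinearMap.sub_apply, LinearMap.smul_apply, Module.End.mul_apply] at h
  rwa [show i + 1 - (a : ℤ) = i - a + 1 by ring, show j + 1 - (b : ℤ) = j - b + 1 by ring]

/-- The coefficient form of `(z − w)[x̄(z), x̄(w)] = 0`. -/
lemma IsQCurrent.XbarApp_commutator_succ (hX : IsQCurrent q X) (hK : CondMinus q X Km)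
    (i j : ℤ) (v : V) :
    XbarApp X Km (i + 1) (XbarApp X Km j v) - XbarApp X Km j (XbarApp X Km (i + 1) v) =
      XbarApp X Km i (XbarApp X Km (j + 1) v) - XbarApp X Km (j + 1) (XbarApp X Km i v) := by
  obtain ⟨N, hN⟩ := (hK.eventually_apply_eq_zero v).exists
  have h₁ := hK.XbarApp_XbarApp_sub hN i j
  have h₂ := hK.XbarApp_XbarApp_sub hN j i
  have h₃ := hX.normalOrdered_sub hK N v i j
  rw [← h₁, ← neg_sub (normalOrdered X Km N v (j + 1) i), ← h₂] at h₃
  rw [← sub_eq_zero] at h₃ ⊢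
  rw [← h₃]
  abel

end ModifiedCurrent

/-- **Commutativity of the modified current (Theorem 1).**  For a truncating `q`-current
`X` and `K⁻` satisfying (I)–(II), the modified modes pairwise commute:
`x̄(z)x̄(w) = x̄(w)x̄(z)` for `x̄(z) = x(z)k⁻(z)`. -/
theorem stmt_3 {K : Type*} [Field K] [CharZero K] {V : Type*} [AddCommGroup V] [Module K V]
    (q : K) (hq : q ≠ 0) (hq2 : q ^ 2 ≠ 1)
    (X : ℤ → Module.End K V) (Km : ℕ → Module.End K V)
    (hX : IsQCurrent q X) (hXt : Truncating X) (hK : CondMinus q X Km) :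
    ∀ (i j : ℤ) (v : V),
      XbarApp X Km i (XbarApp X Km j v) = XbarApp X Km j (XbarApp X Km i v) := by
  intro i j v
  set C : ℤ → ℤ → V := fun k l =>
    XbarApp X Km k (XbarApp X Km l v) - XbarApp X Km l (XbarApp X Km k v)
  have step (k l : ℤ) : C (k + 1) l = C k (l + 1) := hX.XbarApp_commutator_succ hK k l v
  have shift (n : ℕ) : ∀ k l : ℤ, C (k + n) l = C k (l + n) := by
    induction n with
    | zero => simp
    | succ n ih =>
      intro k l
      rw [show k + ((n + 1 : ℕ) : ℤ) = k + n + 1 by push_cast; ring, step, ih,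
        show l + 1 + (n : ℤ) = l + ((n + 1 : ℕ) : ℤ) by push_cast; ring]
  have symm : C i j = C j i := by
    rcases le_total i j with h | h
    · obtain ⟨n, rfl⟩ := Int.le.dest h
      exact (shift n i i).symm
    · obtain ⟨n, rfl⟩ := Int.le.dest h
      exact shift n j j
  have anti : C j i = -C i j := (neg_sub _ _).symm
  have two : (2 : K) • C i j = 0 := by
    rw [two_smul]
    exact eq_neg_iff_add_eq_zero.mp (symm.trans anti)
  exact sub_eq_zero.mp ((smul_eq_zero.mp two).resolve_left two_ne_zero)
end

section
/- Let K be a field of characteristic zero, q ∈ K nonzero with q² ≠ 1, and V a K-vector space. Let X : ℤ → End_K(V) be a truncating q-current and let K⁺ : ℕ → End_K(V) satisfy conditions (I′)–(II′) for X; let X̃_j be the associated modified current modes. Then for all i, j ∈ ℤ: X̃_{i+1}∘X̃_j − X̃_i∘X̃_{j+1} = X̃_j∘X̃_{i+1} − X̃_{j+1}∘X̃_i. (This is the coefficient form of the identity (z−w)·x̃(z)x̃(w) = (z−w)·x̃(w)x̃(z) for x̃(w) = k⁺(w)x(w).) -/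
/-- Conditions (I′)–(II′) for `K⁺ : ℕ → End V` relative to a current `X`:
`K⁺_0 = id`, the `K⁺_a` pairwise commute, and
`K⁺_a∘X_b = X_b∘K⁺_a + Σ_{r=1}^{a} (q^{2r} − q^{2r−2})·X_{b−r}∘K⁺_{a−r}`, the coefficient
form (with `(z−w)/(zq²−w)` expanded in `z/w`) of
`k⁺(z)x(w) = ((z−w)/(zq²−w))·x(w)k⁺(z)` for `k⁺(z) = Σ_{a≥0} K⁺_a z^{a}`. -/
def CondPlus {K : Type*} [Field K] {V : Type*} [AddCommGroup V] [Module K V]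
    (q : K) (X : ℤ → Module.End K V) (Kp : ℕ → Module.End K V) : Prop :=
  Kp 0 = 1 ∧ (∀ a b : ℕ, Kp a * Kp b = Kp b * Kp a) ∧
    (∀ (a : ℕ) (b : ℤ), Kp a * X b =
      X b * Kp a +
        ∑ r ∈ Finset.Icc 1 a, (q ^ (2 * r) - q ^ (2 * r - 2)) • (X (b - (r : ℤ)) * Kp (a - r)))

/-- The modified current mode `X̃_j`, applied to a vector:
`X̃_j v = Σ_{a≥0} K⁺_a(X_{j+a} v)` (a finite sum when `X` is truncating); `X̃_j` is the
coefficient of `w^{−j}` in `x̃(w) = k⁺(w)x(w)`. -/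
noncomputable def XtildeApp {K : Type*} [Field K] {V : Type*} [AddCommGroup V] [Module K V]
    (X : ℤ → Module.End K V) (Kp : ℕ → Module.End K V) (j : ℤ) (v : V) : V :=
  ∑ᶠ a : ℕ, Kp a (X (j + (a : ℤ)) v)

open Filter in
/-- For a truncating current, the modified modes are given by all large enough partial sums. -/
lemma Truncating.eventually_XtildeApp_eq {K : Type*} [Field K] {V : Type*} [AddCommGroup V]
    [Module K V] {X : ℤ → Module.End K V} (hX : Truncating X) (Kp : ℕ → Module.End K V)
    (j : ℤ) (v : V) :
    ∀ᶠ m : ℕ in atTop, XtildeApp X Kp j v = ∑ a ∈ Finset.range m, Kp a (X (j + a) v) := by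
  obtain ⟨N, hN⟩ := hX v
  filter_upwards [eventually_ge_atTop (N - j).toNat] with m hm
  refine finsum_eq_sum_of_support_subset _ fun a ha => ?_
  by_contra ham
  simp only [Finset.coe_range, Set.mem_Iio, not_lt] at ham
  exact ha (by simp [hN (j + a) (by omega)])

/-- Clearing the denominator in (II′):
`(z − q²w)·k⁺(w)x(z) = (z − w)·x(z)k⁺(w)`, in coefficients. -/
lemma CondPlus.mul_sub_mul {K : Type*} [Field K] {V : Type*} [AddCommGroup V] [Module K V]
    {q : K} {X : ℤ → Module.End K V} {Kp : ℕ → Module.End K V} (hK : CondPlus q X Kp)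
    (a : ℕ) (n : ℤ) :
    X (n + 1) * Kp (a + 1) - X n * Kp a =
      Kp (a + 1) * X (n + 1) - q ^ 2 • (Kp a * X n) := by
  have hsum (a : ℕ) (b : ℤ) :
      ∑ r ∈ Finset.Icc 1 a, (q ^ (2 * r) - q ^ (2 * r - 2)) • (X (b - (r : ℤ)) * Kp (a - r)) =
      ∑ r ∈ Finset.range a,
        (q ^ (2 * r + 2) - q ^ (2 * r)) • (X (b - (r : ℤ) - 1) * Kp (a - (r + 1))) := by
    rw [← Finset.Ico_add_one_right_eq_Icc, Finset.sum_Ico_eq_sum_range]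
    refine Finset.sum_congr (by simp) fun r _ => ?_
    rw [show 2 * (1 + r) = 2 * r + 2 by ring, Nat.add_sub_cancel, add_comm 1 r]
    push_cast
    rw [sub_sub]
  have hshift : ∑ r ∈ Finset.range a, (q ^ (2 * (r + 1) + 2) - q ^ (2 * (r + 1))) •
        (X (n + 1 - ((r + 1 : ℕ) : ℤ) - 1) * Kp (a + 1 - (r + 1 + 1))) =
      q ^ 2 • ∑ r ∈ Finset.range a,
        (q ^ (2 * r + 2) - q ^ (2 * r)) • (X (n - (r : ℤ) - 1) * Kp (a - (r + 1))) := by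
    rw [Finset.smul_sum]
    refine Finset.sum_congr rfl fun r _ => ?_
    rw [smul_smul, Nat.add_sub_add_right]
    congr 1
    · ring
    · congr 2
      push_cast
      ring
  rw [hK.2.2 (a + 1), hK.2.2 a, hsum, hsum, Finset.sum_range_succ', hshift]
  simp only [mul_zero, zero_add, pow_zero, Nat.cast_zero, sub_zero, add_sub_cancel_right,
    Nat.add_sub_cancel]
  module

/-- Partial sums of `(z − w)·x(z)k⁺(w)f(w) = (z − q²w)·k⁺(w)x(z)f(w)`. -/
lemma CondPlus.sum_range_sub {K : Type*} [Field K] {V : Type*} [AddCommGroup V] [Module K V]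
    {q : K} {X : ℤ → Module.End K V} {Kp : ℕ → Module.End K V} (hK : CondPlus q X Kp)
    (n : ℤ) (f : ℕ → V) (m : ℕ) :
    ∑ b ∈ Finset.range (m + 1), X (n + 1) (Kp b (f b)) -
        ∑ b ∈ Finset.range m, X n (Kp b (f (b + 1))) =
      ∑ b ∈ Finset.range (m + 1), Kp b (X (n + 1) (f b)) -
        q ^ 2 • ∑ b ∈ Finset.range m, Kp b (X n (f (b + 1))) := by
  induction m with
  | zero => simp [hK.1]
  | succ m ih =>
    have h := LinearMap.congr_fun (hK.mul_sub_mul m n) (f (m + 1))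
    simp only [LinearMap.sub_apply, LinearMap.smul_apply, Module.End.mul_apply] at h
    rw [Finset.sum_range_succ _ (m + 1), Finset.sum_range_succ (fun b => X n (Kp b _)) m,
      Finset.sum_range_succ _ (m + 1), Finset.sum_range_succ (fun b => Kp b (X n _)) m, smul_add,
      add_sub_add_comm, add_sub_add_comm, h, ih]

open Filter in
/-- `(z − w)·x̃(z)x̃(w) = k⁺(z)k⁺(w)·(z − q²w)x(z)x(w)`, in coefficients. -/
lemma CondPlus.eventually_XtildeApp_sub {K : Type*} [Field K] {V : Type*} [AddCommGroup V]
    [Module K V] {q : K} {X : ℤ → Module.End K V} {Kp : ℕ → Module.End K V}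
    (hK : CondPlus q X Kp) (hX : Truncating X) (i j : ℤ) (v : V) :
    ∀ᶠ m : ℕ in atTop,
      XtildeApp X Kp (i + 1) (XtildeApp X Kp j v) - XtildeApp X Kp i (XtildeApp X Kp (j + 1) v) =
        ∑ a ∈ Finset.range m, ∑ b ∈ Finset.range m, Kp a (Kp b
          ((X (i + a + 1) * X (j + b) - q ^ 2 • (X (i + a) * X (j + b + 1))) v)) := by
  obtain ⟨N, hN⟩ := hX v
  filter_upwards [hX.eventually_XtildeApp_eq Kp j v, hX.eventually_XtildeApp_eq Kp (j + 1) v,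
    hX.eventually_XtildeApp_eq Kp (i + 1) (XtildeApp X Kp j v),
    hX.eventually_XtildeApp_eq Kp i (XtildeApp X Kp (j + 1) v),
    eventually_ge_atTop (N - j).toNat] with m h₁ h₂ h₃ h₄ hm
  rw [h₃, h₄, h₁, h₂, ← Finset.sum_sub_distrib]
  refine Finset.sum_congr rfl fun a _ => ?_
  have h := hK.sum_range_sub (i + a) (fun b => X (j + b) v) m
  rw [Finset.sum_range_succ, Finset.sum_range_succ, hN (j + m) (by omega)] at h
  simp only [map_zero, add_zero, Nat.cast_add, Nat.cast_one, ← add_assoc] at h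
  rw [← map_sub, map_sum, map_sum, add_right_comm i 1]
  simp only [add_right_comm j 1]
  rw [h, ← map_sum, Finset.smul_sum, ← Finset.sum_sub_distrib]
  simp

/-- **(z−w)-commutativity of the modified current `x̃`.**  For a truncating `q`-current
`X` and `K⁺` satisfying (I′)–(II′), the modes `X̃_j` of `x̃(w) = k⁺(w)x(w)` satisfy
`X̃_{i+1}∘X̃_j − X̃_i∘X̃_{j+1} = X̃_j∘X̃_{i+1} − X̃_{j+1}∘X̃_i`, the coefficient form of
`(z−w)·x̃(z)x̃(w) = (z−w)·x̃(w)x̃(z)`. -/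
theorem stmt_5 {K : Type*} [Field K] [CharZero K] {V : Type*} [AddCommGroup V] [Module K V]
    (q : K) (hq : q ≠ 0) (hq2 : q ^ 2 ≠ 1)
    (X : ℤ → Module.End K V) (Kp : ℕ → Module.End K V)
    (hX : IsQCurrent q X) (hXt : Truncating X) (hK : CondPlus q X Kp) :
    ∀ (i j : ℤ) (v : V),
      XtildeApp X Kp (i + 1) (XtildeApp X Kp j v) - XtildeApp X Kp i (XtildeApp X Kp (j + 1) v) =
        XtildeApp X Kp j (XtildeApp X Kp (i + 1) v) -
          XtildeApp X Kp (j + 1) (XtildeApp X Kp i v) := by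
  intro i j v
  obtain ⟨m, h₁, h₂⟩ :=
    ((hK.eventually_XtildeApp_sub hXt i j v).and (hK.eventually_XtildeApp_sub hXt j i v)).exists
  rw [h₁, ← neg_sub, h₂, Finset.sum_comm, ← Finset.sum_neg_distrib]
  refine Finset.sum_congr rfl fun b _ => ?_
  rw [← Finset.sum_neg_distrib]
  refine Finset.sum_congr rfl fun a _ => ?_
  rw [hX, ← Module.End.mul_apply, hK.2.1 a b, Module.End.mul_apply, ← map_neg, ← map_neg,
    ← LinearMap.neg_apply, neg_sub]
end

section
/- Let K be a field of characteristic zero, q ∈ K nonzero with q² ≠ 1, and V a K-vector space. Let X : ℤ → End_K(V) be a truncating q-current and let K⁺ : ℕ → End_K(V) satisfy conditions (I′)–(II′) for X; let X̃_j be the associated modified current modes. Then the operators X̃_j pairwise commute: X̃_i∘X̃_j = X̃_j∘X̃_i for all i, j ∈ ℤ. (This is the identity x̃(z)x̃(w) = x̃(w)x̃(z) for the commutative quantum current x̃(w) = k⁺(w)x(w).) -/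
open Filter in
/-- Partial sums of the modified mode eventually agree with it. -/
theorem Truncating.eventually_sum_eq_xtildeApp {K : Type*} [Field K] {V : Type*} [AddCommGroup V]
    [Module K V] {X : ℤ → Module.End K V} (hXt : Truncating X) (Kp : ℕ → Module.End K V)
    (j : ℤ) (v : V) :
    ∀ᶠ N : ℕ in atTop,
      ∑ a ∈ Finset.range N, Kp a (X (j + (a : ℤ)) v) = XtildeApp X Kp j v := by
  obtain ⟨M, hM⟩ := hXt v
  filter_upwards [eventually_ge_atTop (M - j).toNat] with N hN
  refine (finsum_eq_sum_of_support_subset _ fun a ha => ?_).symm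
  by_contra h
  have hNa : N ≤ a := by simpa using h
  exact ha (by simp [hM (j + a) (by omega)])

open Filter in
theorem Truncating.eventually_apply_eq_zero {K : Type*} [Field K] {V : Type*} [AddCommGroup V]
    [Module K V] {X : ℤ → Module.End K V} (hXt : Truncating X) (j : ℤ) (v : V) :
    ∀ᶠ N : ℕ in atTop, X (j + (N : ℤ)) v = 0 := by
  obtain ⟨M, hM⟩ := hXt v
  filter_upwards [eventually_ge_atTop (M - j).toNat] with N hN
  exact hM _ (by omega)

open Filter in
/-- Square partial sums of a product of two modified modes eventually agree with it. -/
theorem Truncating.eventually_sum_sum_eq_xtildeApp {K : Type*} [Field K] {V : Type*}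
    [AddCommGroup V] [Module K V] {X : ℤ → Module.End K V} (hXt : Truncating X)
    (Kp : ℕ → Module.End K V) (i j : ℤ) (v : V) :
    ∀ᶠ N : ℕ in atTop,
      ∑ a ∈ Finset.range N, ∑ b ∈ Finset.range N,
        Kp a (X (i + (a : ℤ)) (Kp b (X (j + (b : ℤ)) v))) =
      XtildeApp X Kp i (XtildeApp X Kp j v) := by
  filter_upwards [hXt.eventually_sum_eq_xtildeApp Kp j v,
    hXt.eventually_sum_eq_xtildeApp Kp i (XtildeApp X Kp j v)] with N h1 h2
  rw [← h2, ← h1]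
  simp only [map_sum]

/-- The coefficient form of `(z − w)x(w)k⁺(z) = (q²z − w)k⁺(z)x(w)`. -/
theorem CondPlus.mul_succ_sub {K : Type*} [Field K] {V : Type*} [AddCommGroup V] [Module K V]
    {q : K} {X : ℤ → Module.End K V} {Kp : ℕ → Module.End K V} (hK : CondPlus q X Kp)
    (m : ℤ) (a : ℕ) :
    X (m + 1) * Kp (a + 1) - Kp (a + 1) * X (m + 1) = X m * Kp a - q ^ 2 • (Kp a * X m) := by
  obtain ⟨-, -, h⟩ := hK
  have key : ∑ r ∈ Finset.Icc 1 (a + 1),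
      (q ^ (2 * r) - q ^ (2 * r - 2)) • (X (m + 1 - (r : ℤ)) * Kp (a + 1 - r)) =
      (q ^ 2 - 1) • (X m * Kp a) + q ^ 2 • ∑ r ∈ Finset.Icc 1 a,
        (q ^ (2 * r) - q ^ (2 * r - 2)) • (X (m - (r : ℤ)) * Kp (a - r)) := by
    have shift (n : ℕ) (g : ℕ → Module.End K V) :
        ∑ r ∈ Finset.Icc 1 n, g r = ∑ s ∈ Finset.range n, g (s + 1) := by
      rw [Finset.range_eq_Ico, Finset.sum_Ico_add' g 0 n 1, zero_add]
      rfl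
    rw [shift, shift, Finset.sum_range_succ', add_comm, Finset.smul_sum]
    congr 1
    · simp
    · refine Finset.sum_congr rfl fun s _ => ?_
      have e1 : m + 1 - ((s + 1 + 1 : ℕ) : ℤ) = m - ((s + 1 : ℕ) : ℤ) := by push_cast; ring
      have e2 : a + 1 - (s + 1 + 1) = a - (s + 1) := by omega
      have e3 : 2 * (s + 1 + 1) - 2 = 2 * s + 2 := by omega
      have e4 : 2 * (s + 1) - 2 = 2 * s := by omega
      rw [e1, e2, e3, e4, smul_smul]
      congr 1
      ring
  rw [h (a + 1) (m + 1), key, h a m]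
  module

/-- The coefficient form of `(z − w)x̃(z)x̃(w) = (z − q²w)k⁺(z)k⁺(w)x(z)x(w)`, for square partial
sums evaluated at a vector killed by the boundary mode. -/
theorem CondPlus.sum_sum_sub_eq {K : Type*} [Field K] {V : Type*} [AddCommGroup V] [Module K V]
    {q : K} {X : ℤ → Module.End K V} {Kp : ℕ → Module.End K V} (hK : CondPlus q X Kp)
    (i j : ℤ) (v : V) (N : ℕ) (hN : X (j + (N : ℤ)) v = 0) :
    ∑ a ∈ Finset.range N, ∑ b ∈ Finset.range N,
        Kp a (X (i + 1 + (a : ℤ)) (Kp b (X (j + (b : ℤ)) v))) -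
      ∑ a ∈ Finset.range N, ∑ b ∈ Finset.range N,
        Kp a (X (i + (a : ℤ)) (Kp b (X (j + 1 + (b : ℤ)) v))) =
    ∑ a ∈ Finset.range N, ∑ b ∈ Finset.range N, Kp a (Kp b
      ((X (i + a + 1) * X (j + b) - q ^ 2 • (X (i + a) * X (j + b + 1))) v)) := by
  rw [← Finset.sum_sub_distrib]
  refine Finset.sum_congr rfl fun a _ => ?_
  rw [← Finset.sum_sub_distrib, ← sub_eq_zero, ← Finset.sum_sub_distrib]
  let f : ℕ → V := fun b => Kp a
    ((X (i + a + 1) * Kp b - Kp b * X (i + a + 1)) (X (j + b) v))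
  have hf : ∀ b : ℕ, f (b + 1) =
      Kp a ((X (i + a) * Kp b - q ^ 2 • (Kp b * X (i + a))) (X (j + b + 1) v)) := by
    intro b
    simp only [f, ← hK.mul_succ_sub, Nat.cast_succ, add_assoc]
  calc _ = ∑ b ∈ Finset.range N, (f b - f (b + 1)) := by
        refine Finset.sum_congr rfl fun b _ => ?_
        rw [hf]
        simp only [f, add_right_comm i 1, add_right_comm j 1, LinearMap.sub_apply,
          Module.End.mul_apply, LinearMap.smul_apply, map_sub, map_smul]
        module
    _ = f 0 - f N := Finset.sum_range_sub' f N
    _ = 0 := by simp [f, hN, hK.1]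

/-- The coefficient form of `(z − w)[x̃(z), x̃(w)] = 0`. -/
theorem xtildeApp_succ_sub {K : Type*} [Field K] {V : Type*} [AddCommGroup V] [Module K V]
    {q : K} {X : ℤ → Module.End K V} {Kp : ℕ → Module.End K V}
    (hX : IsQCurrent q X) (hXt : Truncating X) (hK : CondPlus q X Kp) (i j : ℤ) (v : V) :
    XtildeApp X Kp (i + 1) (XtildeApp X Kp j v) - XtildeApp X Kp j (XtildeApp X Kp (i + 1) v) =
      XtildeApp X Kp i (XtildeApp X Kp (j + 1) v) -
        XtildeApp X Kp (j + 1) (XtildeApp X Kp i v) := by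
  obtain ⟨N, h1, h2, h3, h4, hj, hi⟩ :=
    ((hXt.eventually_sum_sum_eq_xtildeApp Kp (i + 1) j v).and <|
      (hXt.eventually_sum_sum_eq_xtildeApp Kp i (j + 1) v).and <|
      (hXt.eventually_sum_sum_eq_xtildeApp Kp (j + 1) i v).and <|
      (hXt.eventually_sum_sum_eq_xtildeApp Kp j (i + 1) v).and <|
      (hXt.eventually_apply_eq_zero j v).and (hXt.eventually_apply_eq_zero i v)).exists
  have e1 := hK.sum_sum_sub_eq i j v N hj
  have e2 := hK.sum_sum_sub_eq j i v N hi
  rw [h1, h2] at e1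
  rw [h3, h4, Finset.sum_comm] at e2
  rw [sub_eq_sub_iff_sub_eq_sub, e1, ← neg_sub, e2, ← Finset.sum_neg_distrib]
  refine Finset.sum_congr rfl fun a _ => ?_
  rw [← Finset.sum_neg_distrib]
  refine Finset.sum_congr rfl fun b _ => ?_
  rw [hX, ← Module.End.mul_apply (Kp a), ← Module.End.mul_apply (Kp b), hK.2.1 a b, ← map_neg,
    ← LinearMap.neg_apply, neg_sub]

/-- **Commutativity of the modified current `x̃` (Theorem 2).**  For a truncating
`q`-current `X` and `K⁺` satisfying (I′)–(II′), the modified modes pairwise commute: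
`x̃(z)x̃(w) = x̃(w)x̃(z)` for `x̃(w) = k⁺(w)x(w)`. -/
theorem stmt_6 {K : Type*} [Field K] [CharZero K] {V : Type*} [AddCommGroup V] [Module K V]
    (q : K) (hq : q ≠ 0) (hq2 : q ^ 2 ≠ 1)
    (X : ℤ → Module.End K V) (Kp : ℕ → Module.End K V)
    (hX : IsQCurrent q X) (hXt : Truncating X) (hK : CondPlus q X Kp) :
    ∀ (i j : ℤ) (v : V),
      XtildeApp X Kp i (XtildeApp X Kp j v) = XtildeApp X Kp j (XtildeApp X Kp i v) := by
  have shift (n : ℕ) : ∀ (i j : ℤ) (v : V),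
      XtildeApp X Kp (i + n) (XtildeApp X Kp j v) - XtildeApp X Kp j (XtildeApp X Kp (i + n) v) =
        XtildeApp X Kp i (XtildeApp X Kp (j + n) v) -
          XtildeApp X Kp (j + n) (XtildeApp X Kp i v) := by
    induction n with
    | zero => simp
    | succ n ih =>
      intro i j v
      rw [Nat.cast_succ, ← add_assoc, xtildeApp_succ_sub hX hXt hK, ih, add_assoc, add_comm 1,
        ← add_assoc]
  intro i j v
  wlog hij : i ≤ j generalizing i j
  · exact (this j i (le_of_not_ge hij)).symm
  obtain ⟨n, rfl⟩ := Int.le.dest hij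
  have h := shift n i i v
  have : IsAddTorsionFree V := .of_isTorsionFree K V
  rw [← sub_eq_zero, ← self_eq_neg, neg_sub]
  exact h.symm
end

section
/- Let K be a field of characteristic zero, q ∈ K nonzero with q² ≠ 1, V a K-vector space, and I an index set. For each i ∈ I let X^{(i)} : ℤ → End_K(V) be a truncating q-current, let K^{(i)−} : ℕ → End_K(V) satisfy conditions (I)–(II) for X^{(i)}, and let K^{(i)+} : ℕ → End_K(V) satisfy conditions (I′)–(II′) for X^{(i)}; let X̄^{(i)}_j and X̃^{(i)}_j be the associated modified current modes. Then for every i ∈ I and all m, n ∈ ℤ: X̄^{(i)}_m∘X̄^{(i)}_n = X̄^{(i)}_n∘X̄^{(i)}_m and X̃^{(i)}_m∘X̃^{(i)}_n = X̃^{(i)}_n∘X̃^{(i)}_m. (Applied to the simple-root currents x_i⁺(z) of U_q(ŝl(n)), whose diagonal Cartan entry is a_{ii} = 2, this gives x̄_i⁺(z)x̄_i⁺(w) = x̄_i⁺(w)x̄_i⁺(z) and x̃_i⁺(z)x̃_i⁺(w) = x̃_i⁺(w)x̃_i⁺(z).) -/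
section FiniteSums

variable {M : Type*} [AddCommGroup M]

lemma finsum_eq_sum_range_of_forall_le {f : ℕ → M} {N : ℕ} (h : ∀ n, N ≤ n → f n = 0) :
    ∑ᶠ n, f n = ∑ n ∈ Finset.range N, f n := by
  refine finsum_eq_sum_of_support_subset f fun n hn => ?_
  by_contra hN
  exact hn (h n (by simpa using hN))

lemma finsum_eq_zero_add {f : ℕ → M} {N : ℕ} (h : ∀ n, N ≤ n → f n = 0) :
    ∑ᶠ n, f n = f 0 + ∑ᶠ n, f (n + 1) := by
  rw [finsum_eq_sum_range_of_forall_le (N := N + 1) fun n hn => h n (by omega),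
    finsum_eq_sum_range_of_forall_le (N := N) fun n hn => h (n + 1) (by omega),
    Finset.sum_range_succ', add_comm]

lemma finsum_sum_antidiagonal {f : ℕ → ℕ → M} {N : ℕ}
    (h₁ : ∀ r a, N ≤ r → f r a = 0) (h₂ : ∀ r a, N ≤ a → f r a = 0) :
    ∑ᶠ n, ∑ p ∈ Finset.HasAntidiagonal.antidiagonal n, f p.1 p.2 = ∑ᶠ a, ∑ᶠ r, f r a := by
  have hf : ∀ n, ∑ p ∈ Finset.HasAntidiagonal.antidiagonal n, f p.1 p.2 =
      ∑ p ∈ Finset.range N ×ˢ Finset.range N with p.1 + p.2 = n, f p.1 p.2 := by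
    intro n
    symm
    refine Finset.sum_subset (fun p hp => ?_) fun p hp hp' => ?_
    · simp_all
    · rcases le_or_gt N p.1 with h | h
      · exact h₁ _ _ h
      · refine h₂ _ _ (not_lt.1 fun h' => hp' ?_)
        simp_all
  simp_rw [hf]
  rw [finsum_eq_sum_range_of_forall_le (N := 2 * N),
    Finset.sum_fiberwise_of_maps_to, Finset.sum_product_right,
    finsum_eq_sum_range_of_forall_le (N := N)]
  · refine Finset.sum_congr rfl fun a _ => ?_
    exact (finsum_eq_sum_range_of_forall_le fun r hr => h₁ r a hr).symm
  · intro a ha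
    simp [h₂ _ a ha]
  · intro p hp
    simp only [Finset.mem_product, Finset.mem_range] at hp ⊢
    omega
  · intro n hn
    refine Finset.sum_eq_zero fun p hp => ?_
    simp only [Finset.mem_filter, Finset.mem_product, Finset.mem_range] at hp
    omega

lemma add_sum_Icc_eq_sum_antidiagonal (f : ℕ → ℕ → M) (a : ℕ) :
    f 0 a + ∑ r ∈ Finset.Icc 1 a, f r (a - r) =
      ∑ p ∈ Finset.HasAntidiagonal.antidiagonal a, f p.1 p.2 := by
  rw [Finset.Nat.sum_antidiagonal_eq_sum_range_succ f, Finset.range_eq_Ico,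
    Finset.sum_eq_sum_Ico_succ_bot (by omega)]
  rfl

end FiniteSums

section QCurrent

variable {K : Type*} [Field K] {V : Type*} [AddCommGroup V] [Module K V]

/-- The coefficients of the power series `(1 - q² u) / (1 - u)`. -/
def ratioCoeff (q : K) (r : ℕ) : K := if r = 0 then 1 else 1 - q ^ 2

/-- The modes of `(z - q² w) / (z - w) · x(z) x(w)`, expanded in the region `|z| > |w|`. -/
noncomputable def normalizedProduct (q : K) (X : ℤ → Module.End K V) (m n : ℤ) (v : V) : V :=
  ∑ᶠ r : ℕ, ratioCoeff q r • X (m - r) (X (n + r) v)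

lemma Truncating.exists_nat {X : ℤ → Module.End K V} (hX : Truncating X) (n : ℤ) (v : V) :
    ∃ N : ℕ, ∀ r : ℕ, N ≤ r → X (n + r) v = 0 := by
  obtain ⟨N, hN⟩ := hX v
  exact ⟨(N - n).toNat, fun r hr => hN _ (by omega)⟩

lemma normalizedProduct_zero (q : K) (X : ℤ → Module.End K V) (m n : ℤ) :
    normalizedProduct q X m n 0 = 0 := by
  simp [normalizedProduct]

lemma normalizedProduct_eq_zero (q : K) {X : ℤ → Module.End K V} {N : ℤ} {v : V}
    (hN : ∀ n, N ≤ n → X n v = 0) (m : ℤ) {n : ℤ} (hn : N ≤ n) :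
    normalizedProduct q X m n v = 0 := by
  have h : ∀ r : ℕ, X (n + r) v = 0 := fun r => hN _ (by omega)
  simp [normalizedProduct, h]

lemma normalizedProduct_shift (q : K) {X : ℤ → Module.End K V} (hX : Truncating X)
    (m n : ℤ) (v : V) :
    normalizedProduct q X (m + 1) n v =
      X (m + 1) (X n v) - q ^ 2 • X m (X (n + 1) v) + normalizedProduct q X m (n + 1) v := by
  obtain ⟨N, hN⟩ := hX.exists_nat n v
  have hN' : ∀ r : ℕ, N ≤ r → X (n + 1 + r) v = 0 := fun r hr => by
    simpa [add_assoc, add_comm, add_left_comm] using hN (r + 1) (by omega)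
  set T : V := ∑ᶠ r : ℕ, (1 - q ^ 2) • X (m - r) (X (n + 1 + r) v) with hT
  have h₁ : normalizedProduct q X (m + 1) n v = X (m + 1) (X n v) + T := by
    rw [normalizedProduct, finsum_eq_zero_add (N := N) fun r hr => by simp [hN r hr], hT]
    congr 1
    · simp [ratioCoeff]
    · refine finsum_congr fun r => ?_
      simp only [ratioCoeff, Nat.succ_ne_zero, if_false]
      rw [show m + 1 - ((r + 1 : ℕ) : ℤ) = m - r by push_cast; ring,
        show n + ((r + 1 : ℕ) : ℤ) = n + 1 + r by push_cast; ring]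
  have h₂ : normalizedProduct q X m (n + 1) v + -(q ^ 2 • X m (X (n + 1) v)) = T := by
    rw [normalizedProduct, hT, finsum_eq_zero_add (N := N) fun r hr => by simp [hN' r hr],
      finsum_eq_zero_add (N := N) (f := fun r : ℕ => (1 - q ^ 2) • X (m - r) (X (n + 1 + r) v))
        fun r hr => by simp [hN' r hr]]
    simp only [ratioCoeff, Nat.succ_ne_zero, if_false, if_true, Nat.cast_zero, sub_zero, add_zero]
    module
  rw [h₁, ← h₂]
  abel

lemma normalizedProduct_comm [CharZero K] {q : K} {X : ℤ → Module.End K V}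
    (hX : IsQCurrent q X) (hXt : Truncating X) (m n : ℤ) (v : V) :
    normalizedProduct q X m n v = normalizedProduct q X n m v := by
  set D : ℤ → ℤ → V := fun m n => normalizedProduct q X m n v - normalizedProduct q X n m v
    with hD
  have hstep : ∀ m n, D (m + 1) n = D m (n + 1) := by
    intro m n
    have h := congrArg (fun f => f v) (hX m n)
    simp only [LinearMap.sub_apply, LinearMap.smul_apply, Module.End.mul_apply] at h
    simp only [hD]
    rw [normalizedProduct_shift q hXt m n, normalizedProduct_shift q hXt n m, h]
    abel
  have hshift : ∀ (k : ℕ) (m n : ℤ), D (m + k) n = D m (n + k) := by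
    intro k
    induction k with
    | zero => simp
    | succ k ih =>
      intro m n
      have := hstep (m + k) n
      rw [ih m (n + 1)] at this
      push_cast
      rw [← add_assoc, this]
      congr 1
      ring
  have hsymm : ∀ m n, m ≤ n → D n m = D m n := by
    intro m n h
    obtain ⟨k, rfl⟩ := Int.le.dest h
    exact hshift k m m
  have hself : D m n = -D m n := by
    rcases le_total m n with h | h
    · nth_rewrite 1 [← hsymm m n h]
      simp [hD]
    · nth_rewrite 1 [hsymm n m h]
      simp [hD]
  have hdouble : (2 : K) • D m n = 0 := by
    rw [two_smul]
    exact add_eq_zero_iff_eq_neg.2 hself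
  exact sub_eq_zero.1 ((smul_eq_zero.1 hdouble).resolve_left two_ne_zero)

lemma CondMinus.mul_eq_sum_antidiagonal {q : K} {X : ℤ → Module.End K V}
    {Km : ℕ → Module.End K V} (h : CondMinus q X Km) (a : ℕ) (b : ℤ) :
    Km a * X b =
      ∑ p ∈ Finset.HasAntidiagonal.antidiagonal a, ratioCoeff q p.1 • (X (b + p.1) * Km p.2) := by
  rw [h.2.2.2, ← add_sum_Icc_eq_sum_antidiagonal
    (fun r s => ratioCoeff q r • (X (b + r) * Km s)), Finset.smul_sum]
  congr 1
  · simp [ratioCoeff]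
  · refine Finset.sum_congr rfl fun r hr => ?_
    have : r ≠ 0 := by simp at hr; omega
    simp [ratioCoeff, this]

lemma CondMinus.exists_nat {q : K} {X : ℤ → Module.End K V} {Km : ℕ → Module.End K V}
    (h : CondMinus q X Km) (v : V) : ∃ N : ℕ, ∀ a, N ≤ a → Km a v = 0 := by
  obtain ⟨N, hN⟩ := (h.2.2.1 v).bddAbove
  refine ⟨N + 1, fun a ha => ?_⟩
  by_contra hne
  have := hN hne
  omega

lemma XbarApp_sum {q : K} {X : ℤ → Module.End K V} {Km : ℕ → Module.End K V}
    (h : CondMinus q X Km) (m : ℤ) {ι : Type*} (s : Finset ι) (f : ι → V) :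
    XbarApp X Km m (∑ i ∈ s, f i) = ∑ i ∈ s, XbarApp X Km m (f i) := by
  simp only [XbarApp, map_sum]
  refine finsum_sum_comm s _ fun i _ => (h.2.2.1 (f i)).subset fun a ha hz => ha ?_
  simp [hz]

lemma XbarApp_apply_current {q : K} {X : ℤ → Module.End K V} {Km : ℕ → Module.End K V}
    (hX : Truncating X) (h : CondMinus q X Km) (m n : ℤ) (v : V) :
    XbarApp X Km m (X n v) = ∑ᶠ a : ℕ, normalizedProduct q X (m - a) n (Km a v) := by
  obtain ⟨A, hA⟩ := h.exists_nat v
  choose R hR using fun a : ℕ => hX.exists_nat n (Km a v)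
  have hvanish : ∀ r a : ℕ, A ⊔ (Finset.range A).sup R ≤ r → X (n + r) (Km a v) = 0 := by
    intro r a hr
    rcases le_or_gt A a with ha | ha
    · simp [hA a ha]
    · exact hR a r (((Finset.le_sup (Finset.mem_range.2 ha)).trans le_sup_right).trans hr)
  simp only [normalizedProduct]
  rw [← finsum_sum_antidiagonal (N := A ⊔ (Finset.range A).sup R)
    (f := fun r a : ℕ => ratioCoeff q r • X (m - a - r) (X (n + r) (Km a v)))
    (fun r a hr => by simp [hvanish r a hr])
    (fun r a ha => by simp [hA a (le_sup_left.trans ha)])]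
  refine finsum_congr fun a => ?_
  rw [← Module.End.mul_apply (Km a), h.mul_eq_sum_antidiagonal]
  simp only [LinearMap.sum_apply, LinearMap.smul_apply, Module.End.mul_apply, map_sum, map_smul]
  refine Finset.sum_congr rfl fun p hp => ?_
  rw [← Finset.HasAntidiagonal.mem_antidiagonal.1 hp]
  congr 3
  push_cast
  ring

lemma XbarApp_comm [CharZero K] {q : K} {X : ℤ → Module.End K V} {Km : ℕ → Module.End K V}
    (hX : IsQCurrent q X) (hXt : Truncating X) (h : CondMinus q X Km) (m n : ℤ) (v : V) :
    XbarApp X Km m (XbarApp X Km n v) = XbarApp X Km n (XbarApp X Km m v) := by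
  obtain ⟨N, hN⟩ := h.exists_nat v
  have hcomm : ∀ a b, Km a (Km b v) = Km b (Km a v) := fun a b =>
    congrArg (fun f => f v) (h.2.1 a b)
  have hexpand : ∀ m n, XbarApp X Km m (XbarApp X Km n v) =
      ∑ b ∈ Finset.range N, ∑ a ∈ Finset.range N,
        normalizedProduct q X (m - a) (n - b) (Km a (Km b v)) := by
    intro m n
    have hn : XbarApp X Km n v = ∑ b ∈ Finset.range N, X (n - b) (Km b v) :=
      finsum_eq_sum_range_of_forall_le fun b hb => by simp [hN b hb]
    rw [hn, XbarApp_sum h]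
    refine Finset.sum_congr rfl fun b _ => ?_
    rw [XbarApp_apply_current hXt h]
    refine finsum_eq_sum_range_of_forall_le fun a ha => ?_
    rw [hcomm, hN a ha, map_zero, normalizedProduct_zero]
  rw [hexpand, hexpand, Finset.sum_comm]
  refine Finset.sum_congr rfl fun a _ => Finset.sum_congr rfl fun b _ => ?_
  rw [normalizedProduct_comm hX hXt, hcomm]

lemma CondPlus.mul_sub_smul {q : K} {X : ℤ → Module.End K V} {Kp : ℕ → Module.End K V}
    (h : CondPlus q X Kp) (a : ℕ) (b : ℤ) :
    Kp (a + 1) * X b - q ^ 2 • (Kp a * X (b - 1)) =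
      X b * Kp (a + 1) - X (b - 1) * Kp a := by
  rw [h.2.2 (a + 1) b, h.2.2 a (b - 1), ← Finset.Ico_add_one_right_eq_Icc,
    ← Finset.Ico_add_one_right_eq_Icc, Finset.sum_eq_sum_Ico_succ_bot (by omega),
    ← Finset.sum_Ico_add' _ 1 (a + 1) 1, smul_add, Finset.smul_sum]
  have hsum : ∑ r ∈ Finset.Ico 1 (a + 1), (q ^ (2 * (r + 1)) - q ^ (2 * (r + 1) - 2)) •
        (X (b - ((r + 1 : ℕ) : ℤ)) * Kp (a + 1 - (r + 1))) =
      ∑ r ∈ Finset.Ico 1 (a + 1), q ^ 2 • (q ^ (2 * r) - q ^ (2 * r - 2)) •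
        (X (b - 1 - (r : ℤ)) * Kp (a - r)) := by
    refine Finset.sum_congr rfl fun r hr => ?_
    obtain ⟨s, rfl⟩ : ∃ s, r = s + 1 := ⟨r - 1, by simp at hr; omega⟩
    rw [smul_smul, show b - ((s + 1 + 1 : ℕ) : ℤ) = b - 1 - ((s + 1 : ℕ) : ℤ) by push_cast; ring,
      show a + 1 - (s + 1 + 1) = a - (s + 1) by omega,
      show 2 * (s + 1 + 1) - 2 = 2 * s + 2 by omega, show 2 * (s + 1) - 2 = 2 * s by omega]
    congr 1
    ring
  rw [hsum]
  simp only [Nat.cast_one, Nat.add_sub_cancel, mul_one, Nat.sub_self, pow_zero]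
  module

lemma CondPlus.mul_eq_sum_antidiagonal {q : K} {X : ℤ → Module.End K V}
    {Kp : ℕ → Module.End K V} (h : CondPlus q X Kp) (a : ℕ) (b : ℤ) :
    X b * Kp a =
      ∑ p ∈ Finset.HasAntidiagonal.antidiagonal a, ratioCoeff q p.1 • (Kp p.2 * X (b - p.1)) := by
  rw [← add_sum_Icc_eq_sum_antidiagonal
    (fun r s => ratioCoeff q r • (Kp s * X (b - r)))]
  have hcoeff : ∑ r ∈ Finset.Icc 1 a, ratioCoeff q r • (Kp (a - r) * X (b - (r : ℤ))) =
      ∑ r ∈ Finset.Icc 1 a, (1 - q ^ 2) • (Kp (a - r) * X (b - (r : ℤ))) := by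
    refine Finset.sum_congr rfl fun r hr => ?_
    have : r ≠ 0 := by simp at hr; omega
    simp [ratioCoeff, this]
  rw [hcoeff]
  simp only [ratioCoeff, if_true, one_smul, Nat.cast_zero, sub_zero]
  clear hcoeff
  induction a generalizing b with
  | zero => simp [h.1]
  | succ a ih =>
    have hrec := h.mul_sub_smul a b
    rw [← Finset.Ico_add_one_right_eq_Icc, Finset.sum_eq_sum_Ico_succ_bot (by omega),
      ← Finset.sum_Ico_add' _ 1 (a + 1) 1, Finset.Ico_add_one_right_eq_Icc]
    have hsum : ∑ r ∈ Finset.Icc 1 a,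
        (1 - q ^ 2) • (Kp (a + 1 - (r + 1)) * X (b - ((r + 1 : ℕ) : ℤ))) =
        ∑ r ∈ Finset.Icc 1 a, (1 - q ^ 2) • (Kp (a - r) * X (b - 1 - (r : ℤ))) := by
      refine Finset.sum_congr rfl fun r _ => ?_
      rw [show b - ((r + 1 : ℕ) : ℤ) = b - 1 - (r : ℤ) by push_cast; ring,
        Nat.add_sub_add_right]
    rw [hsum, eq_add_of_sub_eq hrec.symm, ih (b - 1)]
    simp only [Nat.cast_one, Nat.add_sub_cancel]
    module

lemma current_apply_XtildeApp {q : K} {X : ℤ → Module.End K V} {Kp : ℕ → Module.End K V}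
    (hX : Truncating X) (h : CondPlus q X Kp) (m n : ℤ) (v : V) :
    X m (XtildeApp X Kp n v) = ∑ᶠ b : ℕ, Kp b (normalizedProduct q X m (n + b) v) := by
  obtain ⟨N, hN⟩ := hX.exists_nat n v
  have hvanish : ∀ r b : ℕ, N ≤ r + b → X (n + b + r) v = 0 := fun r b hrb => by
    simpa [add_assoc, add_comm, add_left_comm] using hN (r + b) hrb
  have hfinite : ∀ b : ℕ, Kp b (normalizedProduct q X m (n + b) v) =
      ∑ᶠ r : ℕ, ratioCoeff q r • Kp b (X (m - r) (X (n + b + r) v)) := by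
    intro b
    rw [normalizedProduct,
      finsum_eq_sum_range_of_forall_le (N := N) fun r hr => by simp [hvanish r b (by omega)],
      finsum_eq_sum_range_of_forall_le (N := N) fun r hr => by simp [hvanish r b (by omega)]]
    simp only [map_sum, map_smul]
  have hX' : X m (XtildeApp X Kp n v) = ∑ᶠ b : ℕ, X m (Kp b (X (n + b) v)) := by
    rw [XtildeApp, finsum_eq_sum_range_of_forall_le (N := N) fun b hb => by simp [hN b hb],
      finsum_eq_sum_range_of_forall_le (N := N) fun b hb => by simp [hN b hb], map_sum]
  simp_rw [hfinite]
  rw [hX', ← finsum_sum_antidiagonal (N := N)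
    (f := fun r b : ℕ => ratioCoeff q r • Kp b (X (m - r) (X (n + b + r) v)))
    (fun r b hr => by simp [hvanish r b (by omega)])
    (fun r b hb => by simp [hvanish r b (by omega)])]
  refine finsum_congr fun b => ?_
  rw [← Module.End.mul_apply (X m), h.mul_eq_sum_antidiagonal]
  simp only [LinearMap.sum_apply, LinearMap.smul_apply, Module.End.mul_apply]
  refine Finset.sum_congr rfl fun p hp => ?_
  rw [← Finset.HasAntidiagonal.mem_antidiagonal.1 hp, Nat.cast_add, add_comm (p.1 : ℤ), add_assoc]

lemma XtildeApp_comm [CharZero K] {q : K} {X : ℤ → Module.End K V} {Kp : ℕ → Module.End K V}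
    (hX : IsQCurrent q X) (hXt : Truncating X) (h : CondPlus q X Kp) (m n : ℤ) (v : V) :
    XtildeApp X Kp m (XtildeApp X Kp n v) = XtildeApp X Kp n (XtildeApp X Kp m v) := by
  obtain ⟨N, hN⟩ := hXt v
  set B : ℕ := (N - m).toNat ⊔ (N - n).toNat with hB
  have hexpand : ∀ m n : ℤ, N ≤ m + B → N ≤ n + B → XtildeApp X Kp m (XtildeApp X Kp n v) =
      ∑ a ∈ Finset.range B, ∑ b ∈ Finset.range B,
        Kp a (Kp b (normalizedProduct q X (m + a) (n + b) v)) := by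
    intro m n hm hn
    have hinner : ∀ a : ℕ, X (m + a) (XtildeApp X Kp n v) =
        ∑ b ∈ Finset.range B, Kp b (normalizedProduct q X (m + a) (n + b) v) := by
      intro a
      rw [current_apply_XtildeApp hXt h]
      refine finsum_eq_sum_range_of_forall_le fun b hb => ?_
      rw [normalizedProduct_eq_zero q hN _ (by omega), map_zero]
    rw [XtildeApp]
    simp_rw [hinner, map_sum]
    refine finsum_eq_sum_range_of_forall_le fun a ha => Finset.sum_eq_zero fun b _ => ?_
    rw [normalizedProduct_comm hX hXt, normalizedProduct_eq_zero q hN _ (by omega), map_zero,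
      map_zero]
  rw [hexpand m n (by omega) (by omega), hexpand n m (by omega) (by omega), Finset.sum_comm]
  refine Finset.sum_congr rfl fun b _ => Finset.sum_congr rfl fun a _ => ?_
  rw [normalizedProduct_comm hX hXt, ← Module.End.mul_apply, h.2.1, Module.End.mul_apply]

end QCurrent

/-- **Theorem 3: commutativity of all modified simple-root currents.**  For each member
`i` of a family of truncating `q`-currents with associated `K⁻`- and `K⁺`-data, the
modified modes `X̄^{(i)}` pairwise commute, and so do the modes `X̃^{(i)}`:
`x̄_i⁺(z)x̄_i⁺(w) = x̄_i⁺(w)x̄_i⁺(z)` and `x̃_i⁺(z)x̃_i⁺(w) = x̃_i⁺(w)x̃_i⁺(z)`. -/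
theorem stmt_8 {K : Type*} [Field K] [CharZero K] {V : Type*} [AddCommGroup V] [Module K V]
    (q : K) (hq : q ≠ 0) (hq2 : q ^ 2 ≠ 1)
    (I : Type*) (X : I → ℤ → Module.End K V)
    (Km : I → ℕ → Module.End K V) (Kp : I → ℕ → Module.End K V)
    (hX : ∀ i, IsQCurrent q (X i)) (hXt : ∀ i, Truncating (X i))
    (hKm : ∀ i, CondMinus q (X i) (Km i)) (hKp : ∀ i, CondPlus q (X i) (Kp i)) :
    ∀ (i : I) (m n : ℤ) (v : V),
      XbarApp (X i) (Km i) m (XbarApp (X i) (Km i) n v) =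
          XbarApp (X i) (Km i) n (XbarApp (X i) (Km i) m v) ∧
        XtildeApp (X i) (Kp i) m (XtildeApp (X i) (Kp i) n v) =
          XtildeApp (X i) (Kp i) n (XtildeApp (X i) (Kp i) m v) := by
  intro i m n v
  exact ⟨XbarApp_comm (hX i) (hXt i) (hKm i) m n v, XtildeApp_comm (hX i) (hXt i) (hKp i) m n v⟩
end

section
/- Let K be a field of characteristic different from 2 and q ∈ K nonzero with q² ≠ −1. Let R = K[x_i : i ∈ ℤ, i ≤ −1] be the polynomial ring in commuting variables x_i indexed by negative integers, and for each integer m ≤ −2 let S_m = Σ_{a+b=m, a≤−1, b≤−1} (q^{2a} + q^{2b})·x_a x_b ∈ R. Let I be the ideal of R generated by all S_m (m ≤ −2). Then the quotient R/I is spanned, as a K-vector space, by the image of 1 together with the images of the monomials x_{i_1}x_{i_2}⋯x_{i_n} (n ≥ 1) with i_1 ≤ i_2 ≤ ⋯ ≤ i_n ≤ −1 and i_{j+1} − i_j ≥ 2 for all 1 ≤ j ≤ n−1. -/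
open MvPolynomial

/-- The variable `x_i` of the polynomial ring `K[x_i : i ≤ -1]`, extended by `0`
for indices that are not ≤ -1 (only the values at `i ≤ -1` are ever used). -/
noncomputable def xvar (K : Type*) [Field K] (i : ℤ) :
    MvPolynomial {i : ℤ // i ≤ -1} K :=
  if h : i ≤ -1 then X ⟨i, h⟩ else 0

/-- `S_m = Σ_{a+b=m, a≤-1, b≤-1} (q^{2a} + q^{2b})·x_a x_b`, the coefficient of `z^{-m}`
in the level-1 quantum integrability relation `x̄⁺(z)x̄⁺(zq²) = 0`. -/
noncomputable def Srel (K : Type*) [Field K] (q : K) (m : ℤ) :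
    MvPolynomial {i : ℤ // i ≤ -1} K :=
  ∑ a ∈ Finset.Icc (m + 1) (-1 : ℤ),
    (q ^ (2 * a) + q ^ (2 * (m - a))) • (xvar K a * xvar K (m - a))

/-- The ideal generated by the relations `S_m`, `m ≤ -2`. -/
noncomputable def Irel (K : Type*) [Field K] (q : K) :
    Ideal (MvPolynomial {i : ℤ // i ≤ -1} K) :=
  Ideal.span {r | ∃ m : ℤ, m ≤ -2 ∧ r = Srel K q m}

/-- For `a ≤ b ≤ a + 1`, the relation `S_{a+b}` rewrites `x_a x_b` in terms of products `x_c x_d`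
with `c + d = a + b` and strictly larger sum of squares. -/
lemma xvar_mul_xvar_mul_mem {K : Type*} [Field K] (h2 : (2 : K) ≠ 0) {q : K} (hq : q ≠ 0)
    (hq2 : q ^ 2 ≠ -1) (T : Submodule K (MvPolynomial {i : ℤ // i ≤ -1} K))
    (hT : ∀ p ∈ Irel K q, p ∈ T) (n : MvPolynomial {i : ℤ // i ≤ -1} K) {a b : ℤ}
    (hab : a ≤ b) (hba : b < a + 2) (hb : b ≤ -1)
    (h : ∀ c d : ℤ, c ≤ -1 → d ≤ -1 → c + d = a + b → a ^ 2 + b ^ 2 < c ^ 2 + d ^ 2 →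
      xvar K c * xvar K d * n ∈ T) :
    xvar K a * xvar K b * n ∈ T := by
  have hS : Srel K q (a + b) * n ∈ T :=
    hT _ (Ideal.mul_mem_right _ _ (Ideal.subset_span ⟨a + b, by omega, rfl⟩))
  have hsub : ({a, b} : Finset ℤ) ⊆ Finset.Icc (a + b + 1) (-1) := by
    intro c hc
    simp only [Finset.mem_insert, Finset.mem_singleton] at hc
    simp only [Finset.mem_Icc]
    omega
  rw [Srel, ← Finset.sum_sdiff hsub, add_mul] at hS
  have hrest : (∑ c ∈ Finset.Icc (a + b + 1) (-1) \ {a, b},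
      (q ^ (2 * c) + q ^ (2 * (a + b - c))) • (xvar K c * xvar K (a + b - c))) * n ∈ T := by
    rw [Finset.sum_mul]
    refine T.sum_mem fun c hc => ?_
    simp only [Finset.mem_sdiff, Finset.mem_Icc, Finset.mem_insert, Finset.mem_singleton,
      not_or] at hc
    obtain ⟨⟨hc1, hc2⟩, hca, hcb⟩ := hc
    rw [smul_mul_assoc]
    refine T.smul_mem _ (h _ _ hc2 (by omega) (by omega) ?_)
    have : 0 < (c - a) * (c - b) := by
      rcases lt_or_gt_of_ne hca with h1 | h1
      · exact mul_pos_of_neg_of_neg (by omega) (by omega)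
      · exact mul_pos (by omega) (by omega)
    nlinarith
  have hlead := (T.add_mem_iff_right hrest).1 hS
  obtain rfl | rfl : b = a ∨ b = a + 1 := by omega
  · have hne : q ^ (2 * b) + q ^ (2 * b) ≠ 0 := by
      rw [← two_mul]
      exact mul_ne_zero h2 (zpow_ne_zero _ hq)
    simp only [Finset.pair_eq_singleton, Finset.sum_singleton, add_sub_cancel_right,
      smul_mul_assoc] at hlead
    exact (T.smul_mem_iff hne).1 hlead
  · have hne : 2 * (q ^ (2 * a) + q ^ (2 * (a + 1))) ≠ 0 := by
      have : q ^ (2 * a) + q ^ (2 * (a + 1)) = q ^ (2 * a) * (1 + q ^ 2) := by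
        rw [mul_add 2 a 1, zpow_add₀ hq]
        norm_cast
        ring
      rw [this]
      refine mul_ne_zero h2 (mul_ne_zero (zpow_ne_zero _ hq) fun h0 => hq2 ?_)
      linear_combination h0
    rw [Finset.sum_pair (by omega), add_sub_cancel_left, add_sub_cancel_right,
      mul_comm (xvar K (a + 1)), add_comm (q ^ (2 * (a + 1))), ← add_smul, ← two_mul,
      smul_mul_assoc] at hlead
    exact (T.smul_mem_iff hne).1 hlead

/-- A weakly increasing list of integers either has all gaps at least `2`, or contains two
entries at distance at most `1`. -/
lemma isChain_or_exists_perm_of_sorted (l : List ℤ) (hl : l.Pairwise (· ≤ ·)) :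
    l.IsChain (fun a b => a + 2 ≤ b) ∨
      ∃ (a b : ℤ) (t : List ℤ), l.Perm (a :: b :: t) ∧ a ≤ b ∧ b < a + 2 := by
  induction l with
  | nil => exact Or.inl List.isChain_nil
  | cons a l ih =>
    rw [List.pairwise_cons] at hl
    rcases ih hl.2 with h | ⟨c, d, t, hp, hcd⟩
    · cases l with
      | nil => exact Or.inl (List.isChain_singleton a)
      | cons b t =>
        by_cases hab : a + 2 ≤ b
        · exact Or.inl (List.isChain_cons_cons.2 ⟨hab, h⟩)
        · exact Or.inr ⟨a, b, t, List.Perm.refl _, hl.1 b List.mem_cons_self, by omega⟩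
    · refine Or.inr ⟨c, d, a :: t, (hp.cons a).trans ?_, hcd⟩
      exact (List.Perm.swap c a _).trans ((List.Perm.swap d a _).cons c)

lemma sum_sq_le_sq_sum_of_nonpos (M : Multiset ℤ) (hM : ∀ i ∈ M, i ≤ 0) :
    (M.map (· ^ 2)).sum ≤ M.sum ^ 2 := by
  induction M using Multiset.induction_on with
  | empty => simp
  | cons a M ih =>
    have ha := hM a (Multiset.mem_cons_self a M)
    have hM' : ∀ i ∈ M, i ≤ 0 := fun i hi => hM i (Multiset.mem_cons_of_mem hi)
    have hs : M.sum ≤ 0 := by simpa using Multiset.sum_le_card_nsmul M 0 hM'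
    have := ih hM'
    simp only [Multiset.map_cons, Multiset.sum_cons]
    nlinarith [mul_nonneg_of_nonpos_of_nonpos ha hs]

/-- If a subspace contains the relations and all monomials with gaps at least `2`, then it
contains every monomial. -/
lemma multiset_prod_xvar_mem {K : Type*} [Field K] (h2 : (2 : K) ≠ 0) {q : K} (hq : q ≠ 0)
    (hq2 : q ^ 2 ≠ -1) (T : Submodule K (MvPolynomial {i : ℤ // i ≤ -1} K))
    (hT : ∀ p ∈ Irel K q, p ∈ T)
    (hchain : ∀ l : List ℤ, (∀ i ∈ l, i ≤ -1) → l.IsChain (fun a b => a + 2 ≤ b) →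
      (l.map (xvar K)).prod ∈ T)
    (M : Multiset ℤ) (hM : ∀ i ∈ M, i ≤ -1) : (M.map (xvar K)).prod ∈ T := by
  induction hk : (M.sum ^ 2 - (M.map (· ^ 2)).sum).toNat using Nat.strong_induction_on
    generalizing M with
  | _ k ih =>
    have hsort : (M.sort (· ≤ ·) : Multiset ℤ) = M := Multiset.sort_eq M _
    rcases isChain_or_exists_perm_of_sorted _ (Multiset.pairwise_sort M (· ≤ ·)) with
      h | ⟨a, b, t, hp, hab, hba⟩
    · have := hchain _ (fun i hi => hM i ((Multiset.mem_sort _).1 hi)) h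
      rwa [← Multiset.prod_coe, ← Multiset.map_coe, hsort] at this
    · have hMt : M = a ::ₘ b ::ₘ (t : Multiset ℤ) := by
        rw [← hsort, Multiset.cons_coe, Multiset.cons_coe]
        exact Multiset.coe_eq_coe.2 hp
      generalize (t : Multiset ℤ) = N at hMt
      subst hMt
      simp only [Multiset.mem_cons, forall_eq_or_imp] at hM
      obtain ⟨-, hb, hN⟩ := hM
      rw [Multiset.map_cons, Multiset.map_cons, Multiset.prod_cons, Multiset.prod_cons,
        ← mul_assoc]
      refine xvar_mul_xvar_mul_mem h2 hq hq2 T hT _ hab hba hb fun c d hc hd hcd hlt => ?_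
      have hM' : ∀ i ∈ c ::ₘ d ::ₘ N, i ≤ -1 := by
        simpa only [Multiset.mem_cons, forall_eq_or_imp] using ⟨hc, hd, hN⟩
      have hle := sum_sq_le_sq_sum_of_nonpos _ fun i hi => (hM' i hi).trans (by norm_num)
      have := ih _ ?_ (c ::ₘ d ::ₘ N) hM' rfl
      · simpa only [Multiset.map_cons, Multiset.prod_cons, ← mul_assoc] using this
      · rw [← hk]
        simp only [Multiset.map_cons, Multiset.sum_cons, ← add_assoc, hcd] at hle ⊢
        omega

lemma monomial_one_eq_multiset_prod_xvar (K : Type*) [Field K] (s : {i : ℤ // i ≤ -1} →₀ ℕ) :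
    monomial s (1 : K) = ((s.toMultiset.map Subtype.val).map (xvar K)).prod := by
  have hX : xvar K ∘ Subtype.val = (X : {i : ℤ // i ≤ -1} → MvPolynomial _ K) :=
    funext fun i => dif_pos i.2
  rw [Multiset.map_map, hX, Finsupp.toMultiset_map, Finsupp.prod_toMultiset,
    Finsupp.prod_mapDomain_index (by simp) (by simp [pow_add]), monomial_eq]
  simp

/-- **Level-1 straightening.**  Modulo the quadratic relations `S_m` (`m ≤ -2`), the ring
`K[x_i : i ≤ -1]` is spanned over `K` by (the images of) `1` and the monomials
`x_{i_1}⋯x_{i_n}` with `i_1 ≤ ⋯ ≤ i_n ≤ -1` and `i_{j+1} - i_j ≥ 2`. -/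
theorem stmt_10 (K : Type*) [Field K] (h2 : (2 : K) ≠ 0)
    (q : K) (hq : q ≠ 0) (hq2 : q ^ 2 ≠ -1) :
    Submodule.span K
      {p : MvPolynomial {i : ℤ // i ≤ -1} K ⧸ Irel K q |
        ∃ l : List ℤ, (∀ i ∈ l, i ≤ -1) ∧ l.Chain' (fun a b => a + 2 ≤ b) ∧
          p = Ideal.Quotient.mk (Irel K q) (l.map (xvar K)).prod} = ⊤ := by
  set W := Submodule.span K
      {p : MvPolynomial {i : ℤ // i ≤ -1} K ⧸ Irel K q |
        ∃ l : List ℤ, (∀ i ∈ l, i ≤ -1) ∧ l.Chain' (fun a b => a + 2 ≤ b) ∧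
          p = Ideal.Quotient.mk (Irel K q) (l.map (xvar K)).prod}
  let T := W.comap (Ideal.Quotient.mkₐ K (Irel K q)).toLinearMap
  have hT : ∀ p ∈ Irel K q, p ∈ T := fun p hp => by
    have : Ideal.Quotient.mk (Irel K q) p = 0 := Ideal.Quotient.eq_zero_iff_mem.2 hp
    change Ideal.Quotient.mk (Irel K q) p ∈ W
    rw [this]
    exact W.zero_mem
  have hchain : ∀ l : List ℤ, (∀ i ∈ l, i ≤ -1) → l.IsChain (fun a b => a + 2 ≤ b) →
      (l.map (xvar K)).prod ∈ T := fun l h1 h3 => Submodule.subset_span ⟨l, h1, h3, rfl⟩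
  refine eq_top_iff.2 fun p _ => ?_
  obtain ⟨r, rfl⟩ := Ideal.Quotient.mk_surjective p
  change r ∈ T
  rw [r.as_sum]
  refine T.sum_mem fun s _ => ?_
  rw [← mul_one (coeff s r), ← smul_eq_mul, ← smul_monomial, monomial_one_eq_multiset_prod_xvar]
  refine T.smul_mem _ (multiset_prod_xvar_mem h2 hq hq2 T hT hchain _ fun i hi => ?_)
  obtain ⟨j, -, rfl⟩ := Multiset.mem_map.1 hi
  exact j.2
end

section
/- Let K be a field, q ∈ K nonzero with q⁴ ≠ 1, and n ≥ 2. Let f ∈ K[t_1, …, t_n] be a symmetric polynomial such that f vanishes identically under the substitution t_1 = q²t_2, i.e., f(q²t, t, t_3, …, t_n) = 0 as a polynomial in t, t_3, …, t_n. Then f is divisible in K[t_1, …, t_n] by the product ∏_{i≠j} (t_i − q²t_j) (product over all ordered pairs (i, j) with 1 ≤ i, j ≤ n and i ≠ j). -/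
open MvPolynomial

/-- Modulo `X i - g`, a polynomial agrees with the result of substituting `g` for `X i`. -/
theorem X_sub_dvd_sub_subst {σ R : Type*} [CommRing R] [DecidableEq σ] (i : σ)
    (g f : MvPolynomial σ R) :
    X i - g ∣ f - aeval (fun k => if k = i then g else X k) f := by
  induction f using MvPolynomial.induction_on with
  | C a => simp [algebraMap_eq]
  | add p r hp hr =>
    rw [map_add, add_sub_add_comm]
    exact dvd_add hp hr
  | mul_X p k hp =>
    rw [map_mul, aeval_X]
    refine dvd_mul_sub_mul hp ?_
    split_ifs with h
    · rw [h]
    · simp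

theorem X_sub_C_mul_X_dvd_iff {σ R : Type*} [CommRing R] [DecidableEq σ] {i j : σ} (hij : i ≠ j)
    (c : R) (f : MvPolynomial σ R) :
    X i - C c * X j ∣ f ↔ aeval (fun k => if k = i then C c * X j else X k) f = 0 := by
  constructor
  · rintro ⟨g, rfl⟩
    rw [map_mul]
    simp [hij.symm, algebraMap_eq]
  · intro h
    have hdvd := X_sub_dvd_sub_subst i (C c * X j) f
    rw [h, sub_zero] at hdvd
    exact hdvd

theorem prime_X_sub_C_mul_X {σ R : Type*} [CommRing R] [IsDomain R] {i j : σ} (hij : i ≠ j)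
    (c : R) : Prime (X i - C c * X j : MvPolynomial σ R) := by
  classical
  refine ⟨fun h => ?_, fun h => ?_, fun a b h => ?_⟩
  · simpa [hij.symm] using congrArg (eval (Pi.single i (1 : R))) h
  · simpa using h.map (eval (0 : σ → R))
  · simpa only [X_sub_C_mul_X_dvd_iff hij, map_mul, mul_eq_zero] using h

theorem isRelPrime_X_sub_C_mul_X {σ K : Type*} [Field K] {c : K} (hc : c ≠ 0) (hc2 : c ^ 2 ≠ 1)
    {i j k l : σ} (hij : i ≠ j) (hkl : k ≠ l) (hne : (i, j) ≠ (k, l)) :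
    IsRelPrime (X i - C c * X j : MvPolynomial σ K) (X k - C c * X l) := by
  classical
  rw [(prime_X_sub_C_mul_X hij c).irreducible.isRelPrime_iff_not_dvd]
  intro hdvd
  have vanish (x : σ → K) (hx : x i = c * x j) : x k = c * x l := by
    have h := map_dvd (eval x) hdvd
    simpa [hx, sub_eq_zero] using h
  have h₁ := vanish (fun m => if m = i then c else if m = j then 1 else 0) (by simp [hij.symm])
  have h₂ := vanish (fun m => if m = i ∨ m = j then 0 else if m = k then 1 else 0) (by simp)
  grind

theorem exists_perm_apply_eq_apply_eq {α : Type*} {a b i j : α} (hab : a ≠ b) (hij : i ≠ j) :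
    ∃ σ : Equiv.Perm α, σ a = i ∧ σ b = j := by
  classical
  refine ⟨(Equiv.swap a i).trans (Equiv.swap (Equiv.swap a i b) j), ?_, by simp⟩
  have h : i ≠ Equiv.swap a i b := fun h => hab <| by
    simpa using congrArg (Equiv.swap a i) h
  simp [Equiv.swap_apply_of_ne_of_ne h hij]

/-- **Functional model divisibility.**  If a symmetric polynomial
`f(t_1,…,t_n)` vanishes identically under the substitution `t_1 = q² t_2`, then it is
divisible by `∏_{i ≠ j} (t_i − q² t_j)` (product over ordered pairs). -/
theorem stmt_11 (K : Type*) [Field K] (q : K) (hq : q ≠ 0) (hq4 : q ^ 4 ≠ 1)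
    (n : ℕ) (hn : 2 ≤ n) (f : MvPolynomial (Fin n) K)
    (hsym : f.IsSymmetric)
    (hvan : (aeval fun i : Fin n =>
        if i = (⟨0, by omega⟩ : Fin n) then C (q ^ 2) * X (⟨1, by omega⟩ : Fin n)
        else X i) f = 0) :
    (∏ p ∈ Finset.univ.filter (fun p : Fin n × Fin n => p.1 ≠ p.2),
        (X p.1 - C (q ^ 2) * X p.2)) ∣ f := by
  refine Finset.prod_dvd_of_isRelPrime ?_ ?_
  · rintro ⟨i, j⟩ hij ⟨k, l⟩ hkl hne
    refine isRelPrime_X_sub_C_mul_X (pow_ne_zero 2 hq) ?_ (by simpa using hij) (by simpa using hkl)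
      hne
    rwa [← pow_mul]
  · rintro ⟨i, j⟩ hij
    have h01 : (⟨0, by omega⟩ : Fin n) ≠ ⟨1, by omega⟩ := by simp
    obtain ⟨σ, h0, h1⟩ := exists_perm_apply_eq_apply_eq h01
      (show i ≠ j by simpa using hij)
    have hdvd := map_dvd (rename σ) ((X_sub_C_mul_X_dvd_iff h01 _ f).2 hvan)
    simpa [hsym σ, h0, h1] using hdvd
end

section
/- Let k ≥ 1, let K be a field of characteristic zero, and let q ∈ K be transcendental over the prime field ℚ. Let R = K[x_i : i ∈ ℤ, i ≤ −1] be the polynomial ring in commuting variables x_i indexed by negative integers, and for each integer m ≤ −(k+1) let S^{(k+1)}_m = Σ_{a_1+⋯+a_{k+1}=m, all a_j ≤ −1} ( Σ_{σ ∈ 𝔖_{k+1}} q^{2·Σ_{j=1}^{k+1} (j−1)·a_{σ(j)}} ) · x_{a_1}x_{a_2}⋯x_{a_{k+1}} ∈ R, where 𝔖_{k+1} is the symmetric group on k+1 letters. Let I be the ideal of R generated by all S^{(k+1)}_m (m ≤ −(k+1)). Then the quotient R/I is spanned, as a K-vector space, by the image of 1 together with the images of the monomials x_{i_1}x_{i_2}⋯x_{i_n}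 (n ≥ 1) with i_1 ≤ i_2 ≤ ⋯ ≤ i_n ≤ −1 satisfying i_{j+k} − i_j ≥ 2 for all j with 1 ≤ j ≤ n−k. -/
open MvPolynomial

/-- `S^{(k+1)}_m = Σ_{a_1+⋯+a_{k+1}=m, a_j ≤ -1}
(Σ_{σ ∈ 𝔖_{k+1}} q^{2 Σ_j (j-1) a_{σ(j)}}) · x_{a_1}⋯x_{a_{k+1}}`, the coefficient of
`z^{-m}` in the symmetrized level-`k` integrability relation
`x̄⁺(z)x̄⁺(zq²)⋯x̄⁺(zq^{2k}) = 0`.  (Any tuple with all entries `≤ -1` summing to `m`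
automatically has all entries in `[m+k, -1]`.) -/
noncomputable def SrelK (K : Type*) [Field K] (q : K) (k : ℕ) (m : ℤ) :
    MvPolynomial {i : ℤ // i ≤ -1} K :=
  ∑ a ∈ (Fintype.piFinset fun _ : Fin (k + 1) => Finset.Icc (m + (k : ℤ)) (-1 : ℤ)).filter
      (fun a => ∑ j, a j = m),
    (∑ σ : Equiv.Perm (Fin (k + 1)), q ^ (2 * ∑ j : Fin (k + 1), (j : ℤ) * a (σ j))) •
      ∏ j, xvar K (a j)

/-- The ideal generated by the relations `S^{(k+1)}_m`, `m ≤ -(k+1)`. -/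
noncomputable def IrelK (K : Type*) [Field K] (q : K) (k : ℕ) :
    Ideal (MvPolynomial {i : ℤ // i ≤ -1} K) :=
  Ideal.span {r | ∃ m : ℤ, m ≤ -(k + 1 : ℤ) ∧ r = SrelK K q k m}

/-- A nonempty sum of nonpositive powers of a transcendental element does not vanish. -/
theorem Transcendental.sum_zpow_ne_zero {K : Type*} [Field K] [CharZero K] {q : K}
    (hq : Transcendental ℚ q) {ι : Type*} {s : Finset ι} (hs : s.Nonempty) {f : ι → ℤ}
    (hf : ∀ i ∈ s, f i ≤ 0) : ∑ i ∈ s, q ^ f i ≠ 0 := by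
  have hq' : Transcendental ℚ q⁻¹ := fun h => hq (IsAlgebraic.inv_iff.mp h)
  have hP : (∑ i ∈ s, (Polynomial.X : Polynomial ℚ) ^ (-f i).toNat) ≠ 0 := by
    intro h
    have := congrArg (Polynomial.eval 1) h
    simp [Polynomial.eval_finsetSum, hs.ne_empty] at this
  have h := (transcendental_iff.mp hq' _).mt hP
  convert h using 1
  rw [map_sum]
  refine Finset.sum_congr rfl fun i hi => ?_
  rw [map_pow, Polynomial.aeval_X, ← zpow_natCast, Int.toNat_of_nonneg (by linarith [hf i hi]),
    inv_zpow', neg_neg]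

namespace Multiset

theorem exists_eq_replicate_add_replicate {α : Type*} {c d : α} (b : Multiset α)
    (hb : ∀ x ∈ b, x = c ∨ x = d) : ∃ p r : ℕ, b = replicate p c + replicate r d := by
  induction b using Multiset.induction with
  | empty => exact ⟨0, 0, by simp⟩
  | cons x b ih =>
    obtain ⟨p, r, rfl⟩ := ih fun y hy => hb y (mem_cons_of_mem hy)
    rcases hb x (mem_cons_self _ _) with rfl | rfl
    · exact ⟨p + 1, r, by simp [replicate_succ]⟩
    · exact ⟨p, r + 1, by simp [replicate_succ]⟩

theorem eq_of_mem_pair {c : ℤ} {b t : Multiset ℤ} (hb : ∀ x ∈ b, x = c ∨ x = c + 1)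
    (ht : ∀ x ∈ t, x = c ∨ x = c + 1) (hcard : b.card = t.card) (hsum : b.sum = t.sum) :
    b = t := by
  obtain ⟨p, r, rfl⟩ := exists_eq_replicate_add_replicate b hb
  obtain ⟨p', r', rfl⟩ := exists_eq_replicate_add_replicate t ht
  simp only [card_add, card_replicate, sum_add, sum_replicate, nsmul_eq_mul] at hcard hsum
  have hcard' : (p : ℤ) + r = p' + r' := by exact_mod_cast hcard
  have hr : (r : ℤ) = r' := by linear_combination hsum - c * hcard'
  obtain rfl : r = r' := by exact_mod_cast hr
  obtain rfl : p = p' := by omega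
  rfl

theorem sum_map_mul_sub (b : Multiset ℤ) (c : ℤ) :
    (b.map fun x => (x - c) * (x - (c + 1))).sum
      = (b.map (· ^ 2)).sum - (2 * c + 1) * b.sum + b.card * (c * (c + 1)) := by
  induction b using Multiset.induction with
  | empty => simp
  | cons x b ih =>
    simp only [map_cons, sum_cons, card_cons, ih]
    push_cast
    ring

theorem mul_sub_succ_nonneg (x c : ℤ) : 0 ≤ (x - c) * (x - (c + 1)) := by
  rcases le_or_gt x c with h | h
  · exact mul_nonneg_of_nonpos_of_nonpos (by linarith) (by linarith)
  · exact mul_nonneg (by linarith) (by linarith [Int.add_one_le_of_lt h])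

/-- Among integer multisets of given size and sum, one supported on two consecutive integers
is the unique minimizer of the sum of squares. -/
theorem sum_sq_lt_of_mem_pair {c : ℤ} {b t : Multiset ℤ}
    (ht : ∀ x ∈ t, x = c ∨ x = c + 1) (hcard : b.card = t.card) (hsum : b.sum = t.sum)
    (hne : b ≠ t) : (t.map (· ^ 2)).sum < (b.map (· ^ 2)).sum := by
  have h0 : (t.map fun x => (x - c) * (x - (c + 1))).sum = 0 := by
    refine sum_eq_zero fun y hy => ?_
    obtain ⟨x, hx, rfl⟩ := mem_map.mp hy
    rcases ht x hx with rfl | rfl <;> ring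
  have h1 : 0 < (b.map fun x => (x - c) * (x - (c + 1))).sum := by
    have hnn : ∀ y ∈ b.map fun x => (x - c) * (x - (c + 1)), 0 ≤ y := by
      intro y hy
      obtain ⟨x, -, rfl⟩ := mem_map.mp hy
      exact mul_sub_succ_nonneg x c
    refine lt_of_le_of_ne (sum_nonneg hnn) fun h => hne ?_
    refine eq_of_mem_pair (fun x hx => ?_) ht hcard hsum
    have hle := single_le_sum hnn _ (mem_map_of_mem _ hx)
    have hz := le_antisymm (h ▸ hle) (mul_sub_succ_nonneg x c)
    rcases mul_eq_zero.mp hz with h | h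
    · left; linarith
    · right; linarith
  rw [sum_map_mul_sub] at h0 h1
  rw [hcard, hsum] at h1
  linarith

theorem sum_sq_le_sq_sum {s : Multiset ℤ} (hs : ∀ x ∈ s, x ≤ 0) :
    (s.map (· ^ 2)).sum ≤ s.sum ^ 2 ∧ s.sum ≤ 0 := by
  induction s using Multiset.induction with
  | empty => simp
  | cons x s ih =>
    obtain ⟨h1, h2⟩ := ih fun y hy => hs y (mem_cons_of_mem hy)
    have hx := hs x (mem_cons_self _ _)
    simp only [map_cons, sum_cons]
    exact ⟨by nlinarith [mul_nonneg_of_nonpos_of_nonpos hx h2], by linarith⟩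

end Multiset

section Straightening

variable {K : Type*} [Field K]

theorem SrelK_eq_sum_multiset (q : K) (k : ℕ) (m : ℤ) :
    SrelK K q k m =
      ∑ a ∈ (Fintype.piFinset fun _ : Fin (k + 1) => Finset.Icc (m + (k : ℤ)) (-1 : ℤ)).filter
        (fun a => ∑ j, a j = m),
      (∑ σ : Equiv.Perm (Fin (k + 1)), q ^ (2 * ∑ j : Fin (k + 1), (j : ℤ) * a (σ j))) •
        ((Finset.univ.val.map a).map (xvar K)).prod := by
  simp only [SrelK, Multiset.map_map]
  rfl

/-- A submodule containing the products with `u` of all monomials other than `t` having the size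
and sum of `t` also contains the product of `t` with `u`. -/
theorem mk_prod_mem_of_relation [CharZero K] {q : K} (hq : Transcendental ℚ q) {k : ℕ}
    (V : Submodule K (MvPolynomial {i : ℤ // i ≤ -1} K ⧸ IrelK K q k)) {t u : Multiset ℤ}
    (ht : ∀ x ∈ t, x ≤ -1) (hcard : t.card = k + 1)
    (h : ∀ b : Multiset ℤ, (∀ x ∈ b, x ≤ -1) → b.card = t.card → b.sum = t.sum → b ≠ t →
      Ideal.Quotient.mk (IrelK K q k) ((b + u).map (xvar K)).prod ∈ V) :
    Ideal.Quotient.mk (IrelK K q k) ((t + u).map (xvar K)).prod ∈ V := by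
  set m := t.sum with hm
  set A := (Fintype.piFinset fun _ : Fin (k + 1) => Finset.Icc (m + (k : ℤ)) (-1 : ℤ)).filter
      (fun a => ∑ j, a j = m) with hA
  set w : (Fin (k + 1) → ℤ) → K := fun a =>
    ∑ σ : Equiv.Perm (Fin (k + 1)), q ^ (2 * ∑ j : Fin (k + 1), (j : ℤ) * a (σ j)) with hw
  let ms : (Fin (k + 1) → ℤ) → Multiset ℤ := fun a => Finset.univ.val.map a
  have hAle : ∀ a ∈ A, ∀ j, a j ≤ -1 := fun a ha j =>
    (Finset.mem_Icc.mp (Fintype.mem_piFinset.mp (Finset.mem_filter.mp ha).1 j)).2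
  have hmle : m ≤ -(k + 1 : ℤ) := by
    have := Multiset.sum_le_card_nsmul t (-1) ht
    rw [hcard, nsmul_eq_mul] at this
    push_cast at this
    linarith
  have hne : (A.filter fun a => ms a = t).Nonempty := by
    obtain ⟨a, ha⟩ : ∃ a : Fin (k + 1) → ℤ, List.ofFn a = t.toList := by
      rw [← hcard, ← Multiset.length_toList t]
      exact ⟨t.toList.get, List.ofFn_get _⟩
    have hms : ms a = t := by
      rw [← Multiset.coe_toList t, ← ha]
      exact Fin.univ_val_map a
    have hsum : ∑ j, a j = m := by
      rw [hm]
      exact congrArg Multiset.sum hms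
    have hle : ∀ j, a j ≤ -1 := fun j => ht _ (by
      rw [← hms]
      exact Multiset.mem_map_of_mem _ (Finset.mem_univ_val j))
    refine ⟨a, Finset.mem_filter.mpr ⟨Finset.mem_filter.mpr
      ⟨Fintype.mem_piFinset.mpr fun j => Finset.mem_Icc.mpr ⟨?_, hle j⟩, hsum⟩, hms⟩⟩
    have h1 := Finset.sum_le_card_nsmul (Finset.univ.erase j) a (-1) fun i _ => hle i
    rw [Finset.card_erase_of_mem (Finset.mem_univ j), Finset.card_univ, Fintype.card_fin,
      nsmul_eq_mul] at h1
    have h2 := Finset.add_sum_erase Finset.univ a (Finset.mem_univ j)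
    push_cast [Nat.add_sub_cancel] at h1
    linarith
  have hcoeff : (∑ a ∈ A.filter (fun a => ms a = t), w a) ≠ 0 := by
    simp only [hw]
    rw [← Finset.sum_product']
    refine hq.sum_zpow_ne_zero (hne.product Finset.univ_nonempty) fun p hp => ?_
    have hp := hAle _ (Finset.mem_filter.mp (Finset.mem_product.mp hp).1).1
    refine mul_nonpos_of_nonneg_of_nonpos (by norm_num) (Finset.sum_nonpos fun j _ => ?_)
    exact mul_nonpos_of_nonneg_of_nonpos (by positivity) (by linarith [hp (p.2 j)])
  have hrel : ∑ a ∈ A, w a •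
      Ideal.Quotient.mk (IrelK K q k) ((ms a + u).map (xvar K)).prod = 0 := by
    have h0 : Ideal.Quotient.mk (IrelK K q k) (SrelK K q k m * (u.map (xvar K)).prod) = 0 :=
      Ideal.Quotient.eq_zero_iff_mem.mpr
        (Ideal.mul_mem_right _ _ (Ideal.subset_span ⟨m, hmle, rfl⟩))
    rw [SrelK_eq_sum_multiset, Finset.sum_mul, map_sum] at h0
    rw [← h0]
    refine Finset.sum_congr rfl fun a _ => ?_
    rw [Multiset.map_add, Multiset.prod_add, smul_mul_assoc]
    rfl
  rw [← Finset.sum_filter_add_sum_filter_not A (fun a => ms a = t)] at hrel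
  have hleft : ∑ a ∈ A.filter (fun a => ms a = t), w a •
      Ideal.Quotient.mk (IrelK K q k) ((ms a + u).map (xvar K)).prod
      = (∑ a ∈ A.filter (fun a => ms a = t), w a) •
        Ideal.Quotient.mk (IrelK K q k) ((t + u).map (xvar K)).prod := by
    rw [Finset.sum_smul]
    refine Finset.sum_congr rfl fun a ha => ?_
    rw [(Finset.mem_filter.mp ha).2]
  rw [hleft] at hrel
  refine (V.smul_mem_iff hcoeff).mp ?_
  rw [eq_neg_of_add_eq_zero_left hrel]
  refine V.neg_mem (V.sum_mem fun a ha => V.smul_mem _ ?_)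
  obtain ⟨haA, hat⟩ := Finset.mem_filter.mp ha
  refine h _ (fun x hx => ?_) ?_ ?_ hat
  · obtain ⟨j, -, rfl⟩ := Multiset.mem_map.mp hx
    exact hAle a haA j
  · simp [ms, hcard]
  · exact (Finset.mem_filter.mp haA).2

/-- A sorted integer list violating the difference condition splits off `k + 1` entries that are
supported on two consecutive integers. -/
theorem exists_window {l : List ℤ} (hl : l.Pairwise (· ≤ ·)) {j k : ℕ} (hj : j + k < l.length)
    (hlt : l.getD (j + k) 0 < l.getD j 0 + 2) :
    ∃ (c : ℤ) (t u : Multiset ℤ), (l : Multiset ℤ) = t + u ∧ t.card = k + 1 ∧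
      ∀ x ∈ t, x = c ∨ x = c + 1 := by
  refine ⟨l.getD j 0, ((l.drop j).take (k + 1) : List ℤ),
    (l.take j ++ (l.drop j).drop (k + 1) : List ℤ), ?_, ?_, fun x hx => ?_⟩
  · rw [Multiset.coe_add, Multiset.coe_eq_coe]
    conv_lhs => rw [← List.take_append_drop j l, ← List.take_append_drop (k + 1) (l.drop j)]
    exact List.perm_append_comm_assoc _ _ _
  · simp only [Multiset.coe_card, List.length_take, List.length_drop]
    omega
  · obtain ⟨i, hi, rfl⟩ := List.mem_iff_getElem.mp (Multiset.mem_coe.mp hx)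
    simp only [List.length_take, List.length_drop] at hi
    rw [List.getD_eq_getElem _ _ hj, List.getD_eq_getElem _ _ (by omega)] at hlt
    rw [List.getD_eq_getElem _ _ (by omega), List.getElem_take, List.getElem_drop]
    have h1 : l[j] ≤ l[j + i] := hl.rel_get_of_le (a := ⟨j, by omega⟩) (b := ⟨j + i, by omega⟩)
      (by simp)
    have h2 : l[j + i] ≤ l[j + k] := hl.rel_get_of_le (a := ⟨j + i, by omega⟩)
      (b := ⟨j + k, hj⟩) (by simp; omega)
    omega

theorem mk_prod_mem_of_sorted [CharZero K] {q : K} (hq : Transcendental ℚ q) {k : ℕ}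
    (V : Submodule K (MvPolynomial {i : ℤ // i ≤ -1} K ⧸ IrelK K q k))
    (hV : ∀ l : List ℤ, (∀ i ∈ l, i ≤ -1) → l.Pairwise (· ≤ ·) →
      (∀ j : ℕ, j + k < l.length → l.getD j 0 + 2 ≤ l.getD (j + k) 0) →
      Ideal.Quotient.mk (IrelK K q k) (l.map (xvar K)).prod ∈ V)
    (s : Multiset ℤ) (hs : ∀ x ∈ s, x ≤ -1) :
    Ideal.Quotient.mk (IrelK K q k) (s.map (xvar K)).prod ∈ V := by
  obtain ⟨N, hN⟩ : ∃ N : ℕ, s.sum ^ 2 - (s.map (· ^ 2)).sum < N :=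
    ⟨(s.sum ^ 2 - (s.map (· ^ 2)).sum).toNat + 1, by push_cast; omega⟩
  induction N generalizing s with
  | zero =>
    have := (Multiset.sum_sq_le_sq_sum fun x hx => (hs x hx).trans (by norm_num)).1
    push_cast at hN
    linarith
  | succ N ih =>
    have hcoe : ((s.sort (· ≤ ·) : List ℤ) : Multiset ℤ) = s := Multiset.sort_eq _ _
    have hsorted : (s.sort (· ≤ ·)).Pairwise (· ≤ ·) := Multiset.pairwise_sort _ _
    by_cases hgood : ∀ j : ℕ, j + k < (s.sort (· ≤ ·)).length →
        (s.sort (· ≤ ·)).getD j 0 + 2 ≤ (s.sort (· ≤ ·)).getD (j + k) 0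
    · have := hV _ (fun i hi => hs i ((Multiset.mem_sort (· ≤ ·)).mp hi)) hsorted hgood
      rwa [← Multiset.prod_coe, ← Multiset.map_coe, hcoe] at this
    · push Not at hgood
      obtain ⟨j, hj, hlt⟩ := hgood
      obtain ⟨c, t, u, htu, hcard, ht⟩ := exists_window hsorted hj hlt
      rw [hcoe] at htu
      subst htu
      refine mk_prod_mem_of_relation hq V (fun x hx => hs x (Multiset.mem_add.mpr (.inl hx)))
        hcard fun b hb hbcard hbsum hbt => ih _ (fun x hx => ?_) ?_
      · rcases Multiset.mem_add.mp hx with hx | hx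
        · exact hb x hx
        · exact hs x (Multiset.mem_add.mpr (.inr hx))
      · have hsq := Multiset.sum_sq_lt_of_mem_pair ht hbcard hbsum hbt
        simp only [Multiset.map_add, Multiset.sum_add, hbsum] at hN ⊢
        push_cast at hN
        linarith

theorem monomial_eq_smul_prod_xvar (d : {i : ℤ // i ≤ -1} →₀ ℕ) (r : K) :
    monomial d r =
      r • (((Finsupp.toMultiset d).map Subtype.val).map (xvar K)).prod := by
  have hx : xvar K ∘ Subtype.val = (X : {i : ℤ // i ≤ -1} → MvPolynomial _ K) := by
    funext i
    simp [xvar, i.2]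
  rw [Multiset.map_map, hx, Finsupp.toMultiset_map, Finsupp.prod_toMultiset,
    Finsupp.prod_mapDomain_index (by simp) (fun _ _ _ => pow_add _ _ _), monomial_eq,
    smul_eq_C_mul]

end Straightening

/-- **Level-`k` straightening.**  For `q` transcendental, modulo the degree-`(k+1)`
relations `S^{(k+1)}_m` (`m ≤ -(k+1)`), the ring `K[x_i : i ≤ -1]` is spanned over `K` by
(the images of) `1` and the monomials `x_{i_1}⋯x_{i_n}` with
`i_1 ≤ ⋯ ≤ i_n ≤ -1` and `i_{j+k} - i_j ≥ 2`. -/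
theorem stmt_12 (k : ℕ) (hk : 1 ≤ k) (K : Type*) [Field K] [CharZero K]
    (q : K) (hq : Transcendental ℚ q) :
    Submodule.span K
      {p : MvPolynomial {i : ℤ // i ≤ -1} K ⧸ IrelK K q k |
        ∃ l : List ℤ, (∀ i ∈ l, i ≤ -1) ∧ l.Chain' (· ≤ ·) ∧
          (∀ j : ℕ, j + k < l.length → l.getD j 0 + 2 ≤ l.getD (j + k) 0) ∧
          p = Ideal.Quotient.mk (IrelK K q k) (l.map (xvar K)).prod} = ⊤ := by
  refine eq_top_iff.mpr fun p _ => ?_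
  obtain ⟨f, rfl⟩ := Ideal.Quotient.mk_surjective p
  induction f using MvPolynomial.induction_on' with
  | monomial d r =>
    rw [monomial_eq_smul_prod_xvar]
    refine Submodule.smul_mem _ r (mk_prod_mem_of_sorted hq _ (fun l hle hl hgap => ?_) _ ?_)
    · exact Submodule.subset_span ⟨l, hle, hl.isChain, hgap, rfl⟩
    · intro x hx
      obtain ⟨i, -, rfl⟩ := Multiset.mem_map.mp hx
      exact i.2
  | add f g hf hg =>
    rw [map_add]
    exact Submodule.add_mem _ (hf trivial) (hg trivial)
end
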